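/- A 0-iterable cardinal is weakly ineffable and a limit of ineffable cardinals. -/

import Mathlib

/-
Common framework for formalizing "Baby measurable cardinals" (Gitman–Schlicht).

Everything is developed internally to the type `ZFSet` of ZF sets from Mathlib.
A first-order language of set theory with one additional unary predicate symbol
(for an ultrafilter) is introduced, together with its Lévy hierarchy
(Δ₀-, Σₙ- and Πₙ-formulas), and satisfaction in structures whose domain is a
subclass `D` of an ambient type `T` equipped with a membership relation `E`,
an equality interpretation `eqR` and a unary predicate `P`.

Cardinals, ordinals, inaccessibility, the `Vₐ`-hierarchy, the classes `H_θ`,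
weak κ-models, κ-models, basic weak κ-models, `M`-ultrafilters, goodness
(well-foundedness of the ultrapower), weak amenability, and the various
large-cardinal notions of the paper are then defined from this.
-/

set_option maxHeartbeats 1000000
set_option linter.unusedVariables false
set_option linter.dupNamespace false

namespace BabyMeasurable

/-- Formulas of set theory, with variables indexed by `ℕ`, equality, membership,
an extra unary predicate symbol (`pred`, to be interpreted by an ultrafilter),
propositional connectives, bounded quantifiers (`ball i j φ` is `∀ xᵢ ∈ xⱼ, φ`)
and unbounded quantifiers. -/
inductive SetFormula : Type where
  | mem : ℕ → ℕ → SetFormula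
  | eq : ℕ → ℕ → SetFormula
  | pred : ℕ → SetFormula
  | not : SetFormula → SetFormula
  | and : SetFormula → SetFormula → SetFormula
  | or : SetFormula → SetFormula → SetFormula
  | ball : ℕ → ℕ → SetFormula → SetFormula
  | bex : ℕ → ℕ → SetFormula → SetFormula
  | all : ℕ → SetFormula → SetFormula
  | ex : ℕ → SetFormula → SetFormula

namespace SetFormula

/-- The formula does not mention the extra predicate symbol, i.e. it is a formula
of the pure language of set theory. -/
def PredFree : SetFormula → Prop
  | mem _ _ => True
  | eq _ _ => True
  | pred _ => False
  | not φ => φ.PredFree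
  | and φ ψ => φ.PredFree ∧ ψ.PredFree
  | or φ ψ => φ.PredFree ∧ ψ.PredFree
  | ball _ _ φ => φ.PredFree
  | bex _ _ φ => φ.PredFree
  | all _ φ => φ.PredFree
  | ex _ φ => φ.PredFree

/-- Δ₀-formulas: all quantifiers are bounded. -/
def IsDelta0 : SetFormula → Prop
  | mem _ _ => True
  | eq _ _ => True
  | pred _ => True
  | not φ => φ.IsDelta0
  | and φ ψ => φ.IsDelta0 ∧ ψ.IsDelta0
  | or φ ψ => φ.IsDelta0 ∧ ψ.IsDelta0
  | ball _ _ φ => φ.IsDelta0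
  | bex _ _ φ => φ.IsDelta0
  | all _ _ => False
  | ex _ _ => False

mutual
  /-- Σₙ-formulas of the Lévy hierarchy (with a Δ₀ matrix). -/
  inductive IsSigma : ℕ → SetFormula → Prop where
    | of_delta0 {n : ℕ} {φ : SetFormula} : φ.IsDelta0 → IsSigma n φ
    | of_pi {n : ℕ} {φ : SetFormula} : IsPi n φ → IsSigma (n + 1) φ
    | exI {n : ℕ} (k : ℕ) {φ : SetFormula} :
        IsSigma (n + 1) φ → IsSigma (n + 1) (SetFormula.ex k φ)
  /-- Πₙ-formulas of the Lévy hierarchy (with a Δ₀ matrix). -/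
  inductive IsPi : ℕ → SetFormula → Prop where
    | of_delta0 {n : ℕ} {φ : SetFormula} : φ.IsDelta0 → IsPi n φ
    | of_sigma {n : ℕ} {φ : SetFormula} : IsSigma n φ → IsPi (n + 1) φ
    | allI {n : ℕ} (k : ℕ) {φ : SetFormula} :
        IsPi (n + 1) φ → IsPi (n + 1) (SetFormula.all k φ)
end

end SetFormula

variable {T : Type*}

/-- Satisfaction of a formula in the structure with domain `D ⊆ T`, membership
relation `E`, equality interpreted by `eqR` and the unary predicate interpreted
by `P`, under the variable assignment `v`. -/
def Interp (E eqR : T → T → Prop) (P D : Set T) : SetFormula → (ℕ → T) → Prop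
  | .mem i j => fun v => E (v i) (v j)
  | .eq i j => fun v => eqR (v i) (v j)
  | .pred i => fun v => v i ∈ P
  | .not φ => fun v => ¬ Interp E eqR P D φ v
  | .and φ ψ => fun v => Interp E eqR P D φ v ∧ Interp E eqR P D ψ v
  | .or φ ψ => fun v => Interp E eqR P D φ v ∨ Interp E eqR P D ψ v
  | .ball i j φ => fun v => ∀ x ∈ D, E x (v j) → Interp E eqR P D φ (Function.update v i x)
  | .bex i j φ => fun v => ∃ x ∈ D, E x (v j) ∧ Interp E eqR P D φ (Function.update v i x)
  | .all i φ => fun v => ∀ x ∈ D, Interp E eqR P D φ (Function.update v i x)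
  | .ex i φ => fun v => ∃ x ∈ D, Interp E eqR P D φ (Function.update v i x)

/-! ### Internal set-theoretic notions relative to a structure `(D, E, eqR)` -/

/-- `a` is a subset of `b`, from the point of view of the structure. -/
def SubG (E eqR : T → T → Prop) (D : Set T) (a b : T) : Prop :=
  ∀ x ∈ D, E x a → E x b

/-- `t` is a transitive set, from the point of view of the structure. -/
def TransG (E eqR : T → T → Prop) (D : Set T) (t : T) : Prop :=
  ∀ x ∈ D, E x t → ∀ y ∈ D, E y x → E y t

/-- `p` is the unordered pair `{x, y}`, from the point of view of the structure. -/
def UPairG (E eqR : T → T → Prop) (D : Set T) (p x y : T) : Prop :=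
  ∀ z ∈ D, (E z p ↔ (eqR z x ∨ eqR z y))

/-- `p` is the (Kuratowski) ordered pair `⟨x, y⟩`, from the point of view of the
structure. -/
def OPairG (E eqR : T → T → Prop) (D : Set T) (p x y : T) : Prop :=
  ∃ s ∈ D, ∃ d ∈ D, E s p ∧ E d p ∧ UPairG E eqR D s x x ∧ UPairG E eqR D d x y ∧
    ∀ z ∈ D, E z p → (eqR z s ∨ eqR z d)

/-- `f(x) = y`, i.e. the ordered pair `⟨x, y⟩` is a member of `f`. -/
def AppG (E eqR : T → T → Prop) (D : Set T) (f x y : T) : Prop :=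
  ∃ p ∈ D, E p f ∧ OPairG E eqR D p x y

/-- `f` is a function with domain `dom`, from the point of view of the structure. -/
def IsFuncOnG (E eqR : T → T → Prop) (D : Set T) (dom f : T) : Prop :=
  (∀ p ∈ D, E p f → ∃ x ∈ D, E x dom ∧ ∃ y ∈ D, OPairG E eqR D p x y) ∧
  (∀ x ∈ D, E x dom → ∃ y ∈ D, AppG E eqR D f x y) ∧
  (∀ x ∈ D, E x dom → ∀ y ∈ D, ∀ y' ∈ D, AppG E eqR D f x y → AppG E eqR D f x y' → eqR y y')

/-- `f` is an injective function from `dom` into `ran`. -/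
def IsInjFunG (E eqR : T → T → Prop) (D : Set T) (dom ran f : T) : Prop :=
  IsFuncOnG E eqR D dom f ∧
  (∀ x ∈ D, ∀ y ∈ D, AppG E eqR D f x y → E y ran) ∧
  (∀ x ∈ D, ∀ x' ∈ D, ∀ y ∈ D, ∀ y' ∈ D,
    AppG E eqR D f x y → AppG E eqR D f x' y' → eqR y y' → eqR x x')

/-- `f` is a bijection between `dom` and `ran`. -/
def IsBijFunG (E eqR : T → T → Prop) (D : Set T) (dom ran f : T) : Prop :=
  IsInjFunG E eqR D dom ran f ∧ ∀ y ∈ D, E y ran → ∃ x ∈ D, E x dom ∧ AppG E eqR D f x y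

/-- `o` is a (von Neumann) ordinal: a transitive set of transitive sets, linearly
ordered by membership. -/
def IsOrdG (E eqR : T → T → Prop) (D : Set T) (o : T) : Prop :=
  TransG E eqR D o ∧ (∀ x ∈ D, E x o → TransG E eqR D x) ∧
  (∀ x ∈ D, E x o → ∀ y ∈ D, E y o → (E x y ∨ eqR x y ∨ E y x))

/-- `c` is a cardinal: an ordinal not bijective with any smaller ordinal. -/
def IsCardG (E eqR : T → T → Prop) (D : Set T) (c : T) : Prop :=
  IsOrdG E eqR D c ∧ ∀ o ∈ D, E o c → ∀ f ∈ D, ¬ IsBijFunG E eqR D o c f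

/-- `s = x ∪ {x}` is the ordinal successor of `x`. -/
def SuccOfG (E eqR : T → T → Prop) (D : Set T) (x s : T) : Prop :=
  ∀ z ∈ D, (E z s ↔ (E z x ∨ eqR z x))

/-- `e` is the empty set. -/
def IsEmptyG (E eqR : T → T → Prop) (D : Set T) (e : T) : Prop := ∀ z ∈ D, ¬ E z e

/-- `w` is the set `ω` of natural numbers: a nonzero ordinal closed under
successors all of whose elements are zero or successors. -/
def IsNatNumbersG (E eqR : T → T → Prop) (D : Set T) (w : T) : Prop :=
  IsOrdG E eqR D w ∧ (∃ e ∈ D, E e w ∧ IsEmptyG E eqR D e) ∧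
  (∀ x ∈ D, E x w → ∃ s ∈ D, E s w ∧ SuccOfG E eqR D x s) ∧
  (∀ x ∈ D, E x w → (IsEmptyG E eqR D x ∨ ∃ p ∈ D, E p w ∧ SuccOfG E eqR D p x))

/-- The cardinal `k` is regular: the range of any function from a smaller ordinal
into `k` is bounded in `k`. -/
def IsRegularG (E eqR : T → T → Prop) (D : Set T) (k : T) : Prop :=
  ∀ o ∈ D, E o k → ∀ f ∈ D, IsFuncOnG E eqR D o f →
    (∀ x ∈ D, ∀ y ∈ D, AppG E eqR D f x y → E y k) →
    ∃ b ∈ D, E b k ∧ ∀ x ∈ D, ∀ y ∈ D, AppG E eqR D f x y → E y b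

/-- `p` is the power set of `a`, from the point of view of the structure. -/
def IsPowG (E eqR : T → T → Prop) (D : Set T) (a p : T) : Prop :=
  ∀ z ∈ D, (E z p ↔ SubG E eqR D z a)

/-- `k` is a strong limit: for every `o ∈ k` the power set of `o` injects into
some element of `k`. -/
def IsStrongLimitG (E eqR : T → T → Prop) (D : Set T) (k : T) : Prop :=
  ∀ o ∈ D, E o k → ∃ p ∈ D, IsPowG E eqR D o p ∧
    ∃ c ∈ D, E c k ∧ ∃ f ∈ D, IsInjFunG E eqR D p c f

/-- `k` is an inaccessible cardinal: an uncountable regular strong limit cardinal. -/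
def IsInaccG (E eqR : T → T → Prop) (D : Set T) (k : T) : Prop :=
  IsCardG E eqR D k ∧ (∃ w ∈ D, IsNatNumbersG E eqR D w ∧ E w k) ∧
  IsRegularG E eqR D k ∧ IsStrongLimitG E eqR D k

/-- `x` belongs to `H_θ`: it is a member of a transitive set of size `< θ`. -/
def InHG (E eqR : T → T → Prop) (D : Set T) (θ x : T) : Prop :=
  ∃ t ∈ D, TransG E eqR D t ∧ E x t ∧ ∃ o ∈ D, E o θ ∧ ∃ f ∈ D, IsBijFunG E eqR D o t f

/-- `v` is the rank-initial segment `V_k` of the universe: there is a function `h`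
with domain `k` satisfying the defining recursion `h(ξ) = ⋃_{η<ξ} P(h(η))` of the
von Neumann hierarchy, and `v` is the union of the range of `h`. -/
def IsVStageG (E eqR : T → T → Prop) (D : Set T) (k v : T) : Prop :=
  ∃ h ∈ D, IsFuncOnG E eqR D k h ∧
    (∀ ξ ∈ D, E ξ k → ∀ y ∈ D, AppG E eqR D h ξ y →
      ∀ z ∈ D, (E z y ↔ ∃ η ∈ D, E η ξ ∧ ∃ w ∈ D, AppG E eqR D h η w ∧ SubG E eqR D z w)) ∧
    (∀ z ∈ D, (E z v ↔ ∃ ξ ∈ D, E ξ k ∧ ∃ w ∈ D, AppG E eqR D h ξ w ∧ E z w))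

/-! ### Schemes and theories -/

/-- The collection axiom for the formula `φ(x, y, parameters)` (with `x, y` the
variables `0, 1`) in the structure `(D, E, eqR, P)`. -/
def CollectionAxG (E eqR : T → T → Prop) (P D : Set T) (φ : SetFormula) : Prop :=
  ∀ v : ℕ → T, (∀ k, v k ∈ D) → ∀ a ∈ D,
    (∀ x ∈ D, E x a → ∃ y ∈ D,
      Interp E eqR P D φ (Function.update (Function.update v 0 x) 1 y)) →
    ∃ b ∈ D, ∀ x ∈ D, E x a → ∃ y ∈ D, E y b ∧
      Interp E eqR P D φ (Function.update (Function.update v 0 x) 1 y)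

/-- The separation axiom for the formula `φ(x, parameters)` (with `x` the
variable `0`) in the structure `(D, E, eqR, P)`. -/
def SeparationAxG (E eqR : T → T → Prop) (P D : Set T) (φ : SetFormula) : Prop :=
  ∀ v : ℕ → T, (∀ k, v k ∈ D) → ∀ a ∈ D, ∃ b ∈ D, ∀ x ∈ D,
    (E x b ↔ (E x a ∧ Interp E eqR P D φ (Function.update v 0 x)))

/-- The axioms of `ZFC⁻` other than the collection and separation schemes:
extensionality, pairing, union, infinity, foundation, and the well-ordering
version of choice (every set is bijective with an ordinal). Note that the power
set axiom is *not* included. -/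
def ModelsBaseG (E eqR : T → T → Prop) (D : Set T) : Prop :=
  (∀ a ∈ D, ∀ b ∈ D, (∀ x ∈ D, (E x a ↔ E x b)) → eqR a b) ∧
  (∀ a ∈ D, ∀ b ∈ D, ∃ p ∈ D, UPairG E eqR D p a b) ∧
  (∀ a ∈ D, ∃ u ∈ D, ∀ z ∈ D, (E z u ↔ ∃ y ∈ D, E y a ∧ E z y)) ∧
  (∃ i ∈ D, (∃ e ∈ D, E e i ∧ IsEmptyG E eqR D e) ∧
    ∀ x ∈ D, E x i → ∃ s ∈ D, E s i ∧ SuccOfG E eqR D x s) ∧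
  (∀ a ∈ D, (∃ x ∈ D, E x a) → ∃ m ∈ D, E m a ∧ ∀ z ∈ D, E z a → ¬ E z m) ∧
  (∀ a ∈ D, ∃ o ∈ D, IsOrdG E eqR D o ∧ ∃ f ∈ D, IsBijFunG E eqR D o a f)

/-- The structure `(D, E, eqR)` with predicate `P` satisfies the base axioms of
`ZFC⁻` together with the collection scheme for formulas in the class `C` and the
separation scheme for formulas in the class `S` (formulas in the language with
the extra predicate). -/
def ModelsG (E eqR : T → T → Prop) (D P : Set T) (C S : SetFormula → Prop) : Prop :=
  ModelsBaseG E eqR D ∧ (∀ φ, C φ → CollectionAxG E eqR P D φ) ∧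
    (∀ φ, S φ → SeparationAxG E eqR P D φ)

/-- The substructure with domain `D₁` (and predicate `P₁`) is an elementary
substructure of the structure with domain `D₂` (and predicate `P₂`) with respect
to all formulas in the class `C`. -/
def ElemG (E eqR : T → T → Prop) (C : SetFormula → Prop) (P₁ P₂ D₁ D₂ : Set T) : Prop :=
  D₁ ⊆ D₂ ∧ ∀ φ, C φ → ∀ v : ℕ → T, (∀ k, v k ∈ D₁) →
    (Interp E eqR P₁ D₁ φ v ↔ Interp E eqR P₂ D₂ φ v)

/-- The class `P` is a uniform normal ultrafilter on (the subsets of) `k`, from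
the point of view of the structure with domain `D`: its members are subsets of
`k` in `D`, it contains `k`, it is closed upwards and under intersections, it is
proper, it decides every subset of `k` in `D`, it contains all tails, and it is
closed under diagonal intersections of sequences in `D`. -/
def IsUFG (E eqR : T → T → Prop) (D : Set T) (k : T) (P : Set T) : Prop :=
  (∀ A ∈ P, A ∈ D ∧ SubG E eqR D A k) ∧
  (∃ a ∈ P, ∀ z ∈ D, (E z a ↔ E z k)) ∧
  (∀ A ∈ P, ∀ B ∈ D, SubG E eqR D A B → SubG E eqR D B k → B ∈ P) ∧
  (∀ A ∈ P, ∀ B ∈ P, ∃ c ∈ P, ∀ z ∈ D, (E z c ↔ (E z A ∧ E z B))) ∧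
  (∀ A ∈ P, ∃ z ∈ D, E z A) ∧
  (∀ A ∈ D, SubG E eqR D A k → (A ∈ P ∨ ∃ c ∈ P, ∀ z ∈ D, (E z c ↔ (E z k ∧ ¬ E z A)))) ∧
  (∀ ξ ∈ D, E ξ k → ∃ t ∈ P, ∀ z ∈ D, (E z t ↔ (E z k ∧ E ξ z))) ∧
  (∀ F ∈ D, IsFuncOnG E eqR D k F →
    (∀ ξ ∈ D, E ξ k → ∀ y ∈ D, AppG E eqR D F ξ y → y ∈ P) →
    ∃ d ∈ P, ∀ β ∈ D,
      (E β d ↔ (E β k ∧ ∀ ξ ∈ D, E ξ β → ∀ y ∈ D, AppG E eqR D F ξ y → E β y)))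

/-- Weak amenability of the predicate `P` over the model with domain `Dm`:
for every `A ∈ Dm` of size `k` in the model, `A ∩ P` is a member of the model. -/
def WeakAmenG (E eqR : T → T → Prop) (D : Set T) (Dm : Set T) (k : T) (P : Set T) : Prop :=
  ∀ A ∈ Dm, (∃ f ∈ Dm, IsBijFunG E eqR D k A f) →
    ∃ c ∈ Dm, ∀ z ∈ D, (E z c ↔ (E z A ∧ z ∈ P))

/-! ### Specialization to `ZFSet` -/

/-- The membership relation on `ZFSet`. -/
abbrev zmem : ZFSet → ZFSet → Prop := (· ∈ ·)

/-- Equality on `ZFSet`. -/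
abbrev zeq : ZFSet → ZFSet → Prop := (· = ·)

/-- The set of members of a `ZFSet`. -/
def memsOf (M : ZFSet) : Set ZFSet := {x | x ∈ M}

def ZApp (f x y : ZFSet) : Prop := AppG zmem zeq Set.univ f x y
def ZIsFuncOn (d f : ZFSet) : Prop := IsFuncOnG zmem zeq Set.univ d f
def ZIsBijFun (d r f : ZFSet) : Prop := IsBijFunG zmem zeq Set.univ d r f
def ZIsOrd (o : ZFSet) : Prop := IsOrdG zmem zeq Set.univ o
def ZIsCard (c : ZFSet) : Prop := IsCardG zmem zeq Set.univ c
def ZIsRegularCard (c : ZFSet) : Prop := ZIsCard c ∧ IsRegularG zmem zeq Set.univ c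
def ZIsInacc (k : ZFSet) : Prop := IsInaccG zmem zeq Set.univ k
def ZInH (θ x : ZFSet) : Prop := InHG zmem zeq Set.univ θ x
def ZIsVStage (k v : ZFSet) : Prop := IsVStageG zmem zeq Set.univ k v
def ZIsTransitive (t : ZFSet) : Prop := TransG zmem zeq Set.univ t

/-- `t` is the cardinal successor `k⁺` of the cardinal `k`. -/
def ZIsSuccCardOf (k t : ZFSet) : Prop :=
  ZIsCard t ∧ k ∈ t ∧ ∀ c : ZFSet, ZIsCard c → k ∈ c → (t = c ∨ t ∈ c)

/-- `f` is the constant function on `d` with value `c`. -/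
def IsConstFunOn (d c f : ZFSet) : Prop :=
  ZIsFuncOn d f ∧ ∀ ξ y : ZFSet, ZApp f ξ y → y = c

/-- `⟨D, ∈⟩ ⊨ ZFC⁻` (in the pure language of set theory, with full collection
and separation). -/
def ModelsZFCminusPure (D : Set ZFSet) : Prop :=
  ModelsG zmem zeq D (∅ : Set ZFSet) SetFormula.PredFree SetFormula.PredFree

/-- `⟨D, ∈, U⟩ ⊨ ZFC⁻`, with full collection and separation in the language with
a predicate for `U`. -/
def ModelsZFCminusU (D U : Set ZFSet) : Prop :=
  ModelsG zmem zeq D U (fun _ => True) (fun _ => True)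

/-- `⟨D, ∈, U⟩ ⊨ ZFC⁻ₙ`: collection and separation are restricted to
Σₙ-formulas (in the language with a predicate for `U`). -/
def ModelsZFCminusN (n : ℕ) (D U : Set ZFSet) : Prop :=
  ModelsG zmem zeq D U (SetFormula.IsSigma n) (SetFormula.IsSigma n)

/-- `⟨D, ∈, U⟩ ⊨ KPₙ`: collection is restricted to Σₙ-formulas and separation to
Δ₀-formulas (in the language with a predicate for `U`). -/
def ModelsKP (n : ℕ) (D U : Set ZFSet) : Prop :=
  ModelsG zmem zeq D U (SetFormula.IsSigma n) SetFormula.IsDelta0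

/-- `M` is a weak κ-model: κ is inaccessible and `M` is a transitive model of
`ZFC⁻` of size κ with `V_κ ∈ M`. -/
def IsWeakKappaModel (k M : ZFSet) : Prop :=
  ZIsInacc k ∧ ZIsTransitive M ∧ (∃ f : ZFSet, ZIsBijFun k M f) ∧
  (∃ v : ZFSet, v ∈ M ∧ ZIsVStage k v) ∧ ModelsZFCminusPure (memsOf M)

/-- `M` is closed under sequences of length `< α`: every function with domain an
ordinal `β ∈ α` and values in `M` is a member of `M`. -/
def SeqClosed (α M : ZFSet) : Prop :=
  ∀ β f : ZFSet, β ∈ α → ZIsFuncOn β f →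
    (∀ ξ y : ZFSet, ZApp f ξ y → y ∈ M) → f ∈ M

/-- `M` is a κ-model: a weak κ-model closed under `< κ`-sequences. -/
def IsKappaModel (k M : ZFSet) : Prop := IsWeakKappaModel k M ∧ SeqClosed k M

/-- `M` is a Σ₀-elementary substructure of the universe `V` of all sets. -/
def Sigma0ElemInV (M : ZFSet) : Prop :=
  ElemG zmem zeq (fun φ => φ.IsDelta0 ∧ φ.PredFree) ∅ ∅ (memsOf M) Set.univ

/-- `M` is a basic weak κ-model: κ is inaccessible and `M` is a (not necessarily
transitive) model of `ZFC⁻` of size κ with `M ≺_{Σ₀} V` and `V_κ ∪ {V_κ} ⊆ M`. -/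
def IsBasicWeakKappaModel (k M : ZFSet) : Prop :=
  ZIsInacc k ∧ (∃ f : ZFSet, ZIsBijFun k M f) ∧ Sigma0ElemInV M ∧
  (∃ v : ZFSet, v ∈ M ∧ ZIsVStage k v ∧ v ⊆ M) ∧ ModelsZFCminusPure (memsOf M)

/-- `M` is a basic κ-model: a basic weak κ-model closed under `< κ`-sequences. -/
def IsBasicKappaModel (k M : ZFSet) : Prop := IsBasicWeakKappaModel k M ∧ SeqClosed k M

/-- `U` is an ultrafilter on (the subsets of `k` belonging to) the class `Dm`:
the structure `⟨Dm, ∈, U⟩` satisfies that `U` is a uniform normal ultrafilter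
on `k`. -/
def IsMUltrafilterD (k : ZFSet) (Dm : Set ZFSet) (U : Set ZFSet) : Prop :=
  IsUFG zmem zeq Dm k U

/-- `U` is an `M`-ultrafilter: the structure `⟨M, ∈, U⟩` satisfies that `U` is a
uniform normal ultrafilter on `k`. -/
def IsMUltrafilter (k M : ZFSet) (U : Set ZFSet) : Prop :=
  IsMUltrafilterD k (memsOf M) U

/-- `U` is weakly amenable for `M`: for every `A ∈ M` of size `k` in `M`,
`A ∩ U ∈ M`. -/
def WeaklyAmenable (k M : ZFSet) (U : Set ZFSet) : Prop :=
  WeakAmenG zmem zeq Set.univ (memsOf M) k U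

/-- `f` is a point of the ultrapower of the model `Dm` by an ultrafilter on `k`:
a function in `Dm` with domain `k`. -/
def UltPt (Dm : Set ZFSet) (k f : ZFSet) : Prop := f ∈ Dm ∧ ZIsFuncOn k f

/-- The membership relation of the ultrapower of `Dm` by `U`:
`[f] ∈ [g]` iff `{ξ ∈ k ∣ f(ξ) ∈ g(ξ)} ∈ U`. -/
def UltMem (Dm : Set ZFSet) (k : ZFSet) (U : Set ZFSet) (f g : ZFSet) : Prop :=
  UltPt Dm k f ∧ UltPt Dm k g ∧
  ∃ s ∈ U, ∀ ξ : ZFSet,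
    (ξ ∈ s ↔ (ξ ∈ k ∧ ∃ a b : ZFSet, ZApp f ξ a ∧ ZApp g ξ b ∧ a ∈ b))

/-- The equality relation of the ultrapower of `Dm` by `U`:
`[f] = [g]` iff `{ξ ∈ k ∣ f(ξ) = g(ξ)} ∈ U`. -/
def UltEq (Dm : Set ZFSet) (k : ZFSet) (U : Set ZFSet) (f g : ZFSet) : Prop :=
  UltPt Dm k f ∧ UltPt Dm k g ∧
  ∃ s ∈ U, ∀ ξ : ZFSet,
    (ξ ∈ s ↔ (ξ ∈ k ∧ ∃ a b : ZFSet, ZApp f ξ a ∧ ZApp g ξ b ∧ a = b))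

/-- The ultrafilter `U` on the model `Dm` is good: the ultrapower of `Dm` by `U`
is well-founded. -/
def GoodUltrafilterD (Dm : Set ZFSet) (k : ZFSet) (U : Set ZFSet) : Prop :=
  WellFounded (UltMem Dm k U)

/-- The `M`-ultrafilter `U` is good: the ultrapower of `M` by `U` is
well-founded. -/
def GoodUltrafilter (k M : ZFSet) (U : Set ZFSet) : Prop :=
  GoodUltrafilterD (memsOf M) k U

/-- The class `H_θ` of sets hereditarily of size `< θ`. -/
def HClass (θ : ZFSet) : Set ZFSet := {x | ZInH θ x}

/-- `H_{k⁺}^{Dm}`: the members of the class `Dm` which are hereditarily of size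
`≤ k`. -/
def HkP (k : ZFSet) (Dm : Set ZFSet) : Set ZFSet :=
  {x | x ∈ Dm ∧ ∃ t : ZFSet, ZIsSuccCardOf k t ∧ ZInH t x}

/-- `M ≺ H_θ`: `M` is fully elementary in `H_θ` (in the pure language). -/
def FullElemInH (M θ : ZFSet) : Prop :=
  ElemG zmem zeq SetFormula.PredFree ∅ ∅ (memsOf M) (HClass θ)

/-- `⟨D₁, ∈, U ∩ D₁⟩ ≺_{Σₙ} ⟨D₂, ∈, U⟩`. -/
def SigmaNElem (n : ℕ) (U : Set ZFSet) (D₁ D₂ : Set ZFSet) : Prop :=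
  ElemG zmem zeq (SetFormula.IsSigma n) U U D₁ D₂

/-- `⟨D₁, ∈, U ∩ D₁⟩ ≺ ⟨D₂, ∈, U⟩` (full elementarity in the language with the
predicate). -/
def FullElemWithU (U : Set ZFSet) (D₁ D₂ : Set ZFSet) : Prop :=
  ElemG zmem zeq (fun _ => True) U U D₁ D₂

/-! ### Large cardinal notions -/

/-- κ is faintly `n`-baby measurable: every `A ⊆ κ` is an element of a weak
κ-model `M` for which there is an `M`-ultrafilter `U` (not necessarily good)
such that `⟨M, ∈, U⟩ ⊨ ZFC⁻ₙ`. -/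
def FaintlyNBabyMeasurable (n : ℕ) (k : ZFSet) : Prop :=
  ZIsInacc k ∧ ∀ A : ZFSet, A ⊆ k → ∃ (M : ZFSet) (U : Set ZFSet),
    IsWeakKappaModel k M ∧ A ∈ M ∧ IsMUltrafilter k M U ∧
    ModelsZFCminusN n (memsOf M) U

/-- κ is weakly `n`-baby measurable: as above with `U` additionally good. -/
def WeaklyNBabyMeasurable (n : ℕ) (k : ZFSet) : Prop :=
  ZIsInacc k ∧ ∀ A : ZFSet, A ⊆ k → ∃ (M : ZFSet) (U : Set ZFSet),
    IsWeakKappaModel k M ∧ A ∈ M ∧ IsMUltrafilter k M U ∧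
    GoodUltrafilter k M U ∧ ModelsZFCminusN n (memsOf M) U

/-- κ is `n`-baby measurable: as above with `M` additionally a κ-model. -/
def NBabyMeasurable (n : ℕ) (k : ZFSet) : Prop :=
  ZIsInacc k ∧ ∀ A : ZFSet, A ⊆ k → ∃ (M : ZFSet) (U : Set ZFSet),
    IsKappaModel k M ∧ A ∈ M ∧ IsMUltrafilter k M U ∧
    GoodUltrafilter k M U ∧ ModelsZFCminusN n (memsOf M) U

/-- κ is `[n]`-baby measurable: every `A ⊆ κ` is an element of a κ-model `M` for
which there is a good `M`-ultrafilter `U` such that `⟨M, ∈, U⟩ ⊨ KPₙ`. -/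
def BracketNBabyMeasurable (n : ℕ) (k : ZFSet) : Prop :=
  ZIsInacc k ∧ ∀ A : ZFSet, A ⊆ k → ∃ (M : ZFSet) (U : Set ZFSet),
    IsKappaModel k M ∧ A ∈ M ∧ IsMUltrafilter k M U ∧
    GoodUltrafilter k M U ∧ ModelsKP n (memsOf M) U

/-- κ is faintly `[n]`-baby measurable: goodness is dropped and `M` is only
required to be a weak κ-model. -/
def FaintlyBracketNBabyMeasurable (n : ℕ) (k : ZFSet) : Prop :=
  ZIsInacc k ∧ ∀ A : ZFSet, A ⊆ k → ∃ (M : ZFSet) (U : Set ZFSet),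
    IsWeakKappaModel k M ∧ A ∈ M ∧ IsMUltrafilter k M U ∧ ModelsKP n (memsOf M) U

/-- κ is weakly `[n]`-baby measurable: `M` is only required to be a weak
κ-model, but `U` is good. -/
def WeaklyBracketNBabyMeasurable (n : ℕ) (k : ZFSet) : Prop :=
  ZIsInacc k ∧ ∀ A : ZFSet, A ⊆ k → ∃ (M : ZFSet) (U : Set ZFSet),
    IsWeakKappaModel k M ∧ A ∈ M ∧ IsMUltrafilter k M U ∧
    GoodUltrafilter k M U ∧ ModelsKP n (memsOf M) U

/-- κ is faintly baby measurable: every `A ⊆ κ` is an element of a weak κ-model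
`M` for which there is an `M`-ultrafilter `U` such that `⟨M, ∈, U⟩ ⊨ ZFC⁻`. -/
def FaintlyBabyMeasurable (k : ZFSet) : Prop :=
  ZIsInacc k ∧ ∀ A : ZFSet, A ⊆ k → ∃ (M : ZFSet) (U : Set ZFSet),
    IsWeakKappaModel k M ∧ A ∈ M ∧ IsMUltrafilter k M U ∧
    ModelsZFCminusU (memsOf M) U

/-- κ is weakly baby measurable: as above with `U` additionally good. -/
def WeaklyBabyMeasurable (k : ZFSet) : Prop :=
  ZIsInacc k ∧ ∀ A : ZFSet, A ⊆ k → ∃ (M : ZFSet) (U : Set ZFSet),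
    IsWeakKappaModel k M ∧ A ∈ M ∧ IsMUltrafilter k M U ∧
    GoodUltrafilter k M U ∧ ModelsZFCminusU (memsOf M) U

/-- κ is baby measurable: as above with `M` additionally a κ-model. -/
def BabyMeasurable (k : ZFSet) : Prop :=
  ZIsInacc k ∧ ∀ A : ZFSet, A ⊆ k → ∃ (M : ZFSet) (U : Set ZFSet),
    IsKappaModel k M ∧ A ∈ M ∧ IsMUltrafilter k M U ∧
    GoodUltrafilter k M U ∧ ModelsZFCminusU (memsOf M) U

/-- κ is locally measurable: every `A ⊆ κ` is an element of a weak κ-model `M`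
containing a set `u` which `M` thinks is a (uniform) normal ultrafilter on κ. -/
def LocallyMeasurable (k : ZFSet) : Prop :=
  ZIsInacc k ∧ ∀ A : ZFSet, A ⊆ k → ∃ M u : ZFSet,
    IsWeakKappaModel k M ∧ A ∈ M ∧ u ∈ M ∧ IsMUltrafilter k M (memsOf u)

/-- κ is `(α, n)`-baby measurable: for every `A ⊆ κ` and arbitrarily large
cardinals θ there is a `< α`-closed basic weak κ-model `M ≺ H_θ` with `A ∈ M`
and a good `M`-ultrafilter `U` such that `⟨H_{κ⁺}^M, ∈, U⟩ ⊨ ZFC⁻ₙ`. -/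
def AlphaNBabyMeasurable (α : ZFSet) (n : ℕ) (k : ZFSet) : Prop :=
  ZIsInacc k ∧ ∀ A : ZFSet, A ⊆ k → ∀ θ₀ : ZFSet, ∃ θ : ZFSet, ZIsCard θ ∧ θ₀ ∈ θ ∧
    ∃ (M : ZFSet) (U : Set ZFSet),
      IsBasicWeakKappaModel k M ∧ SeqClosed α M ∧ FullElemInH M θ ∧ A ∈ M ∧
      IsMUltrafilter k M U ∧ GoodUltrafilterD (memsOf M) k U ∧
      ModelsZFCminusN n (HkP k (memsOf M)) U

/-- κ is faintly `(ω, n)`-baby measurable: as for `(ω, n)`-baby measurable, but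
the `M`-ultrafilter is not required to be good. -/
def FaintlyOmegaNBabyMeasurable (n : ℕ) (k : ZFSet) : Prop :=
  ZIsInacc k ∧ ∀ A : ZFSet, A ⊆ k → ∀ θ₀ : ZFSet, ∃ θ : ZFSet, ZIsCard θ ∧ θ₀ ∈ θ ∧
    ∃ (M : ZFSet) (U : Set ZFSet),
      IsBasicWeakKappaModel k M ∧ FullElemInH M θ ∧ A ∈ M ∧
      IsMUltrafilter k M U ∧ ModelsZFCminusN n (HkP k (memsOf M)) U

/-- κ is reflective `(α, n)`-baby measurable: for every `A ⊆ κ` and arbitrarily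
large cardinals θ there is a `< α`-closed basic weak κ-model `M ≺ H_θ` with
`A ∈ M` and a good `M`-ultrafilter `U` such that for every `B ⊆ κ` in `M` there
is a κ-model `M̄ ∈ M` with `B ∈ M̄`, `⟨M̄, ∈, U ∩ M̄⟩ ≺_{Σₙ} ⟨H_{κ⁺}^M, ∈, U⟩`
and `⟨M̄, ∈, U ∩ M̄⟩ ⊨ ZFC⁻ₙ`. -/
def ReflAlphaNBabyMeasurable (α : ZFSet) (n : ℕ) (k : ZFSet) : Prop :=
  ZIsInacc k ∧ ∀ A : ZFSet, A ⊆ k → ∀ θ₀ : ZFSet, ∃ θ : ZFSet, ZIsCard θ ∧ θ₀ ∈ θ ∧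
    ∃ (M : ZFSet) (U : Set ZFSet),
      IsBasicWeakKappaModel k M ∧ SeqClosed α M ∧ FullElemInH M θ ∧ A ∈ M ∧
      IsMUltrafilter k M U ∧ GoodUltrafilterD (memsOf M) k U ∧
      ∀ B : ZFSet, B ∈ M → B ⊆ k → ∃ Mb : ZFSet, Mb ∈ M ∧ IsKappaModel k Mb ∧ B ∈ Mb ∧
        SigmaNElem n U (memsOf Mb) (HkP k (memsOf M)) ∧
        ModelsZFCminusN n (memsOf Mb) U

/-- κ is faintly reflective `(ω, n)`-baby measurable: as for reflective
`(ω, n)`-baby measurable, but the `M`-ultrafilter is not required to be good. -/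
def FaintlyReflOmegaNBabyMeasurable (n : ℕ) (k : ZFSet) : Prop :=
  ZIsInacc k ∧ ∀ A : ZFSet, A ⊆ k → ∀ θ₀ : ZFSet, ∃ θ : ZFSet, ZIsCard θ ∧ θ₀ ∈ θ ∧
    ∃ (M : ZFSet) (U : Set ZFSet),
      IsBasicWeakKappaModel k M ∧ FullElemInH M θ ∧ A ∈ M ∧
      IsMUltrafilter k M U ∧
      ∀ B : ZFSet, B ∈ M → B ⊆ k → ∃ Mb : ZFSet, Mb ∈ M ∧ IsKappaModel k Mb ∧ B ∈ Mb ∧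
        SigmaNElem n U (memsOf Mb) (HkP k (memsOf M)) ∧
        ModelsZFCminusN n (memsOf Mb) U

/-- κ is `α`-baby measurable: the `ZFC⁻` version of `(α, n)`-baby measurable. -/
def AlphaBabyMeasurable (α k : ZFSet) : Prop :=
  ZIsInacc k ∧ ∀ A : ZFSet, A ⊆ k → ∀ θ₀ : ZFSet, ∃ θ : ZFSet, ZIsCard θ ∧ θ₀ ∈ θ ∧
    ∃ (M : ZFSet) (U : Set ZFSet),
      IsBasicWeakKappaModel k M ∧ SeqClosed α M ∧ FullElemInH M θ ∧ A ∈ M ∧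
      IsMUltrafilter k M U ∧ GoodUltrafilterD (memsOf M) k U ∧
      ModelsZFCminusU (HkP k (memsOf M)) U

/-- κ is reflective `α`-baby measurable: the `ZFC⁻`/fully elementary version of
reflective `(α, n)`-baby measurable. -/
def ReflAlphaBabyMeasurable (α k : ZFSet) : Prop :=
  ZIsInacc k ∧ ∀ A : ZFSet, A ⊆ k → ∀ θ₀ : ZFSet, ∃ θ : ZFSet, ZIsCard θ ∧ θ₀ ∈ θ ∧
    ∃ (M : ZFSet) (U : Set ZFSet),
      IsBasicWeakKappaModel k M ∧ SeqClosed α M ∧ FullElemInH M θ ∧ A ∈ M ∧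
      IsMUltrafilter k M U ∧ GoodUltrafilterD (memsOf M) k U ∧
      ∀ B : ZFSet, B ∈ M → B ⊆ k → ∃ Mb : ZFSet, Mb ∈ M ∧ IsKappaModel k Mb ∧ B ∈ Mb ∧
        FullElemWithU U (memsOf Mb) (HkP k (memsOf M)) ∧
        ModelsZFCminusU (memsOf Mb) U

/-! ### Ramsey-like notions -/

/-- κ is strongly Ramsey: every `A ⊆ κ` is an element of a κ-model `M` for which
there is a weakly amenable `M`-ultrafilter. -/
def StronglyRamsey (k : ZFSet) : Prop :=
  ZIsInacc k ∧ ∀ A : ZFSet, A ⊆ k → ∃ (M : ZFSet) (U : Set ZFSet),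
    IsKappaModel k M ∧ A ∈ M ∧ IsMUltrafilter k M U ∧ WeaklyAmenable k M U

/-- κ is `β`-Ramsey (for a regular cardinal `ω ≤ β ≤ κ`): for every `A ⊆ κ` and
arbitrarily large cardinals θ there is a `< β`-closed basic weak κ-model
`M ≺ H_θ` with `A ∈ M` for which there is a good weakly amenable
`M`-ultrafilter. -/
def BetaRamsey (β k : ZFSet) : Prop :=
  ZIsInacc k ∧ ∀ A : ZFSet, A ⊆ k → ∀ θ₀ : ZFSet, ∃ θ : ZFSet, ZIsCard θ ∧ θ₀ ∈ θ ∧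
    ∃ (M : ZFSet) (U : Set ZFSet),
      IsBasicWeakKappaModel k M ∧ SeqClosed β M ∧ FullElemInH M θ ∧ A ∈ M ∧
      IsMUltrafilter k M U ∧ WeaklyAmenable k M U ∧ GoodUltrafilterD (memsOf M) k U

/-- κ is ω-Ramsey: for every `A ⊆ κ` and arbitrarily large cardinals θ there is
a basic weak κ-model `M ≺ H_θ` with `A ∈ M` for which there is a good weakly
amenable `M`-ultrafilter. -/
def OmegaRamsey (k : ZFSet) : Prop :=
  ZIsInacc k ∧ ∀ A : ZFSet, A ⊆ k → ∀ θ₀ : ZFSet, ∃ θ : ZFSet, ZIsCard θ ∧ θ₀ ∈ θ ∧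
    ∃ (M : ZFSet) (U : Set ZFSet),
      IsBasicWeakKappaModel k M ∧ FullElemInH M θ ∧ A ∈ M ∧
      IsMUltrafilter k M U ∧ WeaklyAmenable k M U ∧ GoodUltrafilterD (memsOf M) k U

/-- κ is 0-iterable: every `A ⊆ κ` is an element of a weak κ-model `M` for which
there is a weakly amenable (not necessarily good) `M`-ultrafilter. -/
def ZeroIterable (k : ZFSet) : Prop :=
  ZIsInacc k ∧ ∀ A : ZFSet, A ⊆ k → ∃ (M : ZFSet) (U : Set ZFSet),
    IsWeakKappaModel k M ∧ A ∈ M ∧ IsMUltrafilter k M U ∧ WeaklyAmenable k M U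

/-- `f(x, y) = z` for a function `f` defined on ordered pairs. -/
def ZApp2 (f x y z : ZFSet) : Prop :=
  ∃ q : ZFSet, OPairG zmem zeq Set.univ q x y ∧ ZApp f q z

/-- `f` is a function with domain `k × k`. -/
def ZIsFuncOnPairs (k f : ZFSet) : Prop :=
  (∀ p : ZFSet, p ∈ f → ∃ x y q z : ZFSet, x ∈ k ∧ y ∈ k ∧
    OPairG zmem zeq Set.univ q x y ∧ OPairG zmem zeq Set.univ p q z) ∧
  (∀ x y : ZFSet, x ∈ k → y ∈ k → ∃ z : ZFSet, ZApp2 f x y z) ∧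
  (∀ x y z z' : ZFSet, ZApp2 f x y z → ZApp2 f x y z' → z = z')

/-- The membership relation of the second iterated ultrapower of `Dm` by `U`,
realized as the ultrapower by the 2-fold product of `U` on functions
`f : k × k → Dm` in `Dm`: `[f] ∈ [g]` iff
`{α ∈ k ∣ {β ∈ k ∣ f(α,β) ∈ g(α,β)} ∈ U} ∈ U`. -/
def UltMem2 (Dm : Set ZFSet) (k : ZFSet) (U : Set ZFSet) (f g : ZFSet) : Prop :=
  (f ∈ Dm ∧ ZIsFuncOnPairs k f) ∧ (g ∈ Dm ∧ ZIsFuncOnPairs k g) ∧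
  ∃ s ∈ U, ∀ α : ZFSet,
    (α ∈ s ↔ (α ∈ k ∧ ∃ t ∈ U, ∀ β : ZFSet,
      (β ∈ t ↔ (β ∈ k ∧ ∃ a b : ZFSet, ZApp2 f α β a ∧ ZApp2 g α β b ∧ a ∈ b))))

/-- κ is 2-iterable: every `A ⊆ κ` is an element of a weak κ-model `M` for which
there is a weakly amenable `M`-ultrafilter with 2-many well-founded iterated
ultrapowers. -/
def TwoIterable (k : ZFSet) : Prop :=
  ZIsInacc k ∧ ∀ A : ZFSet, A ⊆ k → ∃ (M : ZFSet) (U : Set ZFSet),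
    IsWeakKappaModel k M ∧ A ∈ M ∧ IsMUltrafilter k M U ∧ WeaklyAmenable k M U ∧
    WellFounded (UltMem (memsOf M) k U) ∧ WellFounded (UltMem2 (memsOf M) k U)

/-! ### Ineffability -/

/-- The thread `A` agrees with the sequence coded by `f` at `α`:
`A ∩ α = f(α)`. -/
def ThreadsAt (f A α : ZFSet) : Prop :=
  ∀ y : ZFSet, ZApp f α y → ∀ z : ZFSet, (z ∈ y ↔ (z ∈ A ∧ z ∈ α))

/-- κ is weakly ineffable: for every sequence `⟨A_α ∣ α < κ⟩` with `A_α ⊆ α`,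
there is `A ⊆ κ` with `A ∩ α = A_α` for unboundedly many `α < κ`. -/
def WeaklyIneffableZ (k : ZFSet) : Prop :=
  ∀ f : ZFSet, ZIsFuncOn k f → (∀ ξ y : ZFSet, ZApp f ξ y → y ⊆ ξ) →
    ∃ A : ZFSet, A ⊆ k ∧ ∀ γ : ZFSet, γ ∈ k →
      ∃ α : ZFSet, α ∈ k ∧ γ ∈ α ∧ ThreadsAt f A α

/-- `C` is a club (closed unbounded) subset of the ordinal `k`. -/
def ClubIn (C k : ZFSet) : Prop :=
  C ⊆ k ∧ (∀ γ : ZFSet, γ ∈ k → ∃ δ : ZFSet, δ ∈ C ∧ γ ∈ δ) ∧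
  (∀ δ : ZFSet, δ ∈ k → (∃ γ : ZFSet, γ ∈ δ) →
    (∀ γ : ZFSet, γ ∈ δ → ∃ ε : ZFSet, ε ∈ C ∧ ε ∈ δ ∧ γ ∈ ε) → δ ∈ C)

/-- The class `S` is stationary in `k`: it meets every club subset of `k`. -/
def StationaryIn (S : Set ZFSet) (k : ZFSet) : Prop :=
  ∀ C : ZFSet, ClubIn C k → ∃ α : ZFSet, α ∈ C ∧ α ∈ S

/-- κ is ineffable: for every sequence `⟨A_α ∣ α < κ⟩` with `A_α ⊆ α`, there is
`A ⊆ κ` such that `{α < κ ∣ A ∩ α = A_α}` is stationary in κ. -/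
def IneffableZ (k : ZFSet) : Prop :=
  ∀ f : ZFSet, ZIsFuncOn k f → (∀ ξ y : ZFSet, ZApp f ξ y → y ⊆ ξ) →
    ∃ A : ZFSet, A ⊆ k ∧ StationaryIn {α | ThreadsAt f A α} k

end BabyMeasurable

namespace BabyMeasurable

/-! ### The games `G^{θ,n}_α(κ)` and `RG^{θ,n}_α(κ)` -/

open scoped Classical in
/-- The restriction of the sequence `J` of judge's moves to stages `ξ ∈ γ`. -/
noncomputable def restrictJ (J : ZFSet → ZFSet × ZFSet) (γ : ZFSet) : ZFSet → ZFSet × ZFSet :=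
  fun ξ => if ξ ∈ γ then J ξ else ((∅ : ZFSet), (∅ : ZFSet))

open scoped Classical in
/-- The restriction of the sequence `Ms` of challenger's moves to stages `ξ ≤ γ`
(the challenger moves first at each stage). -/
noncomputable def restrictC (Ms : ZFSet → ZFSet) (γ : ZFSet) : ZFSet → ZFSet :=
  fun ξ => if (ξ ∈ γ ∨ ξ = γ) then Ms ξ else (∅ : ZFSet)

/-- The challenger's move `M` at stage `γ` is legal (for the game with
parameters `k`, `θ`, judge history `Js`): `M` is a basic κ-model elementary in
`H_θ` containing the sequence `⟨⟨N_ξ, U_ξ⟩ ∣ ξ < γ⟩` of the judge's previous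
moves as an element. -/
def ChMoveOK (k θ : ZFSet) (Js : ZFSet → ZFSet × ZFSet) (γ M : ZFSet) : Prop :=
  IsBasicKappaModel k M ∧ FullElemInH M θ ∧
  ∃ s : ZFSet, s ∈ M ∧ ZIsFuncOn γ s ∧
    ∀ ξ : ZFSet, ξ ∈ γ →
      ∃ p : ZFSet, OPairG zmem zeq Set.univ p (Js ξ).1 (Js ξ).2 ∧ ZApp s ξ p

/-- The judge's move `⟨N_γ, U_γ⟩ = Js γ` at stage `γ` is legal: `N_γ` is a
κ-model with `P(κ) ∩ M_γ ⊆ N_γ`, and `U_γ` is an `N_γ`-ultrafilter extending the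
union of her earlier ultrafilters. If `refl = true` (the game `RG`), she must
additionally ensure that `⟨N_γ, ∈, U_γ⟩ ⊨ ZFC⁻ₙ` and that
`⟨N_ξ, ∈, U_ξ⟩ ≺_{Σₙ} ⟨N_γ, ∈, U_γ⟩` for all `ξ < γ`. -/
def JMoveOK (refl : Bool) (n : ℕ) (k : ZFSet) (Ms : ZFSet → ZFSet)
    (Js : ZFSet → ZFSet × ZFSet) (γ : ZFSet) : Prop :=
  IsKappaModel k (Js γ).1 ∧
  (∀ x : ZFSet, x ∈ Ms γ → x ⊆ k → x ∈ (Js γ).1) ∧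
  IsMUltrafilter k (Js γ).1 (memsOf (Js γ).2) ∧
  (∀ ξ : ZFSet, ξ ∈ γ → (Js ξ).2 ⊆ (Js γ).2) ∧
  (refl = true →
    (ModelsZFCminusN n (memsOf (Js γ).1) (memsOf (Js γ).2) ∧
     ∀ ξ : ZFSet, ξ ∈ γ →
       ElemG zmem zeq (SetFormula.IsSigma n) (memsOf (Js ξ).2) (memsOf (Js γ).2)
         (memsOf (Js ξ).1) (memsOf (Js γ).1)))

/-- The union of the challenger's moves at stages `ξ < α`. -/
def unionModel (α : ZFSet) (Ms : ZFSet → ZFSet) : Set ZFSet :=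
  {x | ∃ ξ : ZFSet, ξ ∈ α ∧ x ∈ Ms ξ}

/-- The union of the judge's ultrafilters at stages `ξ < α`. -/
def unionUF (α : ZFSet) (Js : ZFSet → ZFSet × ZFSet) : Set ZFSet :=
  {x | ∃ ξ : ZFSet, ξ ∈ α ∧ x ∈ (Js ξ).2}

/-- The judge wins the run `(Ms, Js)` of length `α`: with `M = ⋃_{ξ<α} M_ξ` and
`U = ⋃_{ξ<α} U_ξ`, `U` is an `M`-ultrafilter (good, if `good = true`), and
`⟨H_{κ⁺}^M, ∈, U⟩ ⊨ ZFC⁻ₙ`. -/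
def RunFinalOK (good : Bool) (n : ℕ) (k α : ZFSet) (Ms : ZFSet → ZFSet)
    (Js : ZFSet → ZFSet × ZFSet) : Prop :=
  IsMUltrafilterD k (unionModel α Ms) (unionUF α Js) ∧
  (good = true → GoodUltrafilterD (unionModel α Ms) k (unionUF α Js)) ∧
  ModelsZFCminusN n (HkP k (unionModel α Ms)) (unionUF α Js)

/-- The challenger's moves induced by the strategy `σ` against the judge's
moves `Js`. -/
noncomputable def chMoves (σ : ZFSet → (ZFSet → ZFSet × ZFSet) → ZFSet)
    (Js : ZFSet → ZFSet × ZFSet) : ZFSet → ZFSet :=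
  fun γ => σ γ (restrictJ Js γ)

/-- The challenger has a winning strategy in the game (of length `α`, with
parameters `θ`, `n`; `refl = true` for the game `RG`, `good = true` unless the
game is a faint one): there is a strategy `σ` producing legal moves whenever all
the judge's previous moves were legal, such that in no run in which the judge
always moves legally against `σ` does the judge win. -/
def ChallengerWins (refl good : Bool) (n : ℕ) (k α θ : ZFSet) : Prop :=
  ∃ σ : ZFSet → (ZFSet → ZFSet × ZFSet) → ZFSet,
    (∀ (Js : ZFSet → ZFSet × ZFSet) (γ : ZFSet), γ ∈ α →
      (∀ ξ : ZFSet, ξ ∈ γ → JMoveOK refl n k (chMoves σ Js) Js ξ) →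
      ChMoveOK k θ Js γ (chMoves σ Js γ)) ∧
    (∀ Js : ZFSet → ZFSet × ZFSet,
      (∀ γ : ZFSet, γ ∈ α → JMoveOK refl n k (chMoves σ Js) Js γ) →
      ¬ RunFinalOK good n k α (chMoves σ Js) Js)

/-- The judge's moves induced by the strategy `τ` against the challenger's
moves `Ms`. -/
noncomputable def jMoves (τ : ZFSet → (ZFSet → ZFSet) → ZFSet × ZFSet)
    (Ms : ZFSet → ZFSet) : ZFSet → ZFSet × ZFSet :=
  fun γ => τ γ (restrictC Ms γ)

/-- The judge has a winning strategy in the game: there is a strategy `τ`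
producing legal moves whenever all the challenger's moves so far were legal,
such that the judge wins every run in which the challenger always moves legally
against `τ`. -/
def JudgeWins (refl good : Bool) (n : ℕ) (k α θ : ZFSet) : Prop :=
  ∃ τ : ZFSet → (ZFSet → ZFSet) → ZFSet × ZFSet,
    (∀ (Ms : ZFSet → ZFSet) (γ : ZFSet), γ ∈ α →
      (∀ ξ : ZFSet, (ξ ∈ γ ∨ ξ = γ) → ChMoveOK k θ (jMoves τ Ms) ξ (Ms ξ)) →
      JMoveOK refl n k Ms (jMoves τ Ms) γ) ∧
    (∀ Ms : ZFSet → ZFSet,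
      (∀ γ : ZFSet, γ ∈ α → ChMoveOK k θ (jMoves τ Ms) γ (Ms γ)) →
      RunFinalOK good n k α Ms (jMoves τ Ms))

/-! ### Internal large-cardinal notions in abstract models of set theory

These are used to express satisfaction of large-cardinal properties inside
(possibly ill-founded) models `(T, E)` of set theory, e.g. in ultrapowers. -/

variable {T : Type*}

/-- `m` is a weak `k`-model, from the point of view of the structure
`(D, E, eqR)`: a transitive model of `ZFC⁻` of size `k` with `V_k ∈ m`. -/
def WeakKappaModelG (E eqR : T → T → Prop) (D : Set T) (k m : T) : Prop :=
  TransG E eqR D m ∧ (∃ f ∈ D, IsBijFunG E eqR D k m f) ∧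
  (∃ v ∈ D, IsVStageG E eqR D k v ∧ E v m) ∧
  ModelsG E eqR {x | x ∈ D ∧ E x m} (∅ : Set T) SetFormula.PredFree SetFormula.PredFree

/-- `m` is closed under sequences of length `< α`, from the point of view of the
structure. -/
def SeqClosedG (E eqR : T → T → Prop) (D : Set T) (α m : T) : Prop :=
  ∀ β ∈ D, E β α → ∀ f ∈ D, IsFuncOnG E eqR D β f →
    (∀ ξ ∈ D, ∀ y ∈ D, AppG E eqR D f ξ y → E y m) → E f m

/-- `m` is a `k`-model, from the point of view of the structure. -/
def KappaModelG (E eqR : T → T → Prop) (D : Set T) (k m : T) : Prop :=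
  WeakKappaModelG E eqR D k m ∧ SeqClosedG E eqR D k m

/-- `m` is a basic weak `k`-model, from the point of view of the structure: a
model of `ZFC⁻` of size `k` which is Σ₀-elementary in the structure and contains
`V_k ∪ {V_k}`. -/
def BasicWeakKappaModelG (E eqR : T → T → Prop) (D : Set T) (k m : T) : Prop :=
  (∃ f ∈ D, IsBijFunG E eqR D k m f) ∧
  ElemG E eqR (fun φ => φ.IsDelta0 ∧ φ.PredFree) ∅ ∅ {x | x ∈ D ∧ E x m} D ∧
  (∃ v ∈ D, IsVStageG E eqR D k v ∧ E v m ∧ SubG E eqR D v m) ∧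
  ModelsG E eqR {x | x ∈ D ∧ E x m} (∅ : Set T) SetFormula.PredFree SetFormula.PredFree

/-- The membership relation of the ultrapower by the ultrafilter (class) `P` on
`k`, from the point of view of the structure: `[f] ∈ [g]` iff the set
`{ξ ∈ k ∣ f(ξ) ∈ g(ξ)}` belongs to `P`. -/
def UltMemIntG (E eqR : T → T → Prop) (D : Set T) (k : T) (P : Set T) (f g : T) : Prop :=
  ∃ s ∈ P, ∀ ξ ∈ D,
    (E ξ s ↔ (E ξ k ∧ ∃ a ∈ D, ∃ b ∈ D, AppG E eqR D f ξ a ∧ AppG E eqR D g ξ b ∧ E a b))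

/-- The ultrapower of the model `m` by the ultrafilter (class) `P` on `k` is
well-founded, from the point of view of the structure: every nonempty set of
functions `k → m` in `m` has an element which is minimal with respect to the
ultrapower membership relation. -/
def GoodIntG (E eqR : T → T → Prop) (D : Set T) (m k : T) (P : Set T) : Prop :=
  ∀ s ∈ D, (∃ f ∈ D, E f s) →
    (∀ f ∈ D, E f s → (E f m ∧ IsFuncOnG E eqR D k f)) →
    ∃ f ∈ D, E f s ∧ ∀ g ∈ D, E g s → ¬ UltMemIntG E eqR D k P g f

/-- `k` is a κ-Ramsey cardinal (with `κ = k`), from the point of view of the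
structure `(D, E, eqR)`: `k` is inaccessible and for every `A ⊆ k` in `D` and
arbitrarily large cardinals `θ` in `D` there are a `< k`-closed basic weak
`k`-model `m` elementary in `H_θ` with `A ∈ m`, and an ultrafilter `u` which is
a good weakly amenable `m`-ultrafilter in the sense of the structure. -/
def InternalKappaRamsey (E eqR : T → T → Prop) (D : Set T) (k : T) : Prop :=
  IsInaccG E eqR D k ∧
  ∀ A ∈ D, SubG E eqR D A k → ∀ θ₀ ∈ D, ∃ θ ∈ D, IsCardG E eqR D θ ∧ E θ₀ θ ∧
    ∃ m ∈ D, ∃ u ∈ D,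
      BasicWeakKappaModelG E eqR D k m ∧ SeqClosedG E eqR D k m ∧
      ElemG E eqR SetFormula.PredFree ∅ ∅
        {x | x ∈ D ∧ E x m} {x | x ∈ D ∧ InHG E eqR D θ x} ∧
      E A m ∧
      IsUFG E eqR {x | x ∈ D ∧ E x m} k {x | x ∈ D ∧ E x u} ∧
      WeakAmenG E eqR D {x | x ∈ D ∧ E x m} k {x | x ∈ D ∧ E x u} ∧
      GoodIntG E eqR D m k {x | x ∈ D ∧ E x u}

/-- `(T, E)` is a model of `ZFC`: it satisfies the base axioms, full collection
and separation (in the pure language), and the power set axiom. -/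
def IsZFCModel (E : T → T → Prop) : Prop :=
  ModelsG E (· = ·) (Set.univ : Set T) (∅ : Set T)
    SetFormula.PredFree SetFormula.PredFree ∧
  ∀ a : T, ∃ p : T, IsPowG E (· = ·) Set.univ a p

/-- `k` is the largest cardinal of the model `(T, E)`. -/
def LargestCardG (E : T → T → Prop) (k : T) : Prop :=
  IsCardG E (· = ·) Set.univ k ∧
  ∀ c : T, IsCardG E (· = ·) Set.univ c → (c = k ∨ E c k)

/-- For every `a ∈ k` the power set of `a` exists and has size `< k`
(the inaccessibility requirement `P(α)` exists and `2^α < κ` of `ZFC⁻_I`). -/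
def InaccPowG (E : T → T → Prop) (k : T) : Prop :=
  ∀ a : T, E a k → ∃ p : T, IsPowG E (· = ·) Set.univ a p ∧
    ∃ c : T, E c k ∧ ∃ f : T, IsInjFunG E (· = ·) Set.univ p c f

/-- `(T, E, P)` is a model of `ZFC⁻_U`: `ZFC⁻` with full collection and
separation in the language with the predicate `U` (interpreted by `P`), a
largest cardinal `k` which is inaccessible, and `U` a uniform normal ultrafilter
on `k`. -/
def IsZFCminusUModel (E : T → T → Prop) (P : Set T) : Prop :=
  ModelsG E (· = ·) (Set.univ : Set T) P (fun _ => True) (fun _ => True) ∧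
  ∃ k : T, LargestCardG E k ∧ InaccPowG E k ∧ IsUFG E (· = ·) Set.univ k P

/-- `k` is an `n`-baby measurable cardinal, from the point of view of the model
`(T, E)`: every `A ⊆ k` is an element of a `k`-model `m` for which there is a
good `m`-ultrafilter `u` such that `⟨m, ∈, u⟩ ⊨ ZFC⁻ₙ`, all in the sense of the
model. -/
def NBabyMeasurableG (E : T → T → Prop) (n : ℕ) (k : T) : Prop :=
  IsInaccG E (· = ·) Set.univ k ∧
  ∀ A : T, SubG E (· = ·) Set.univ A k → ∃ m u : T,
    KappaModelG E (· = ·) Set.univ k m ∧ E A m ∧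
    IsUFG E (· = ·) {x | E x m} k {x | E x u} ∧
    GoodIntG E (· = ·) Set.univ m k {x | E x u} ∧
    ModelsG E (· = ·) {x | E x m} {x | E x u}
      (SetFormula.IsSigma n) (SetFormula.IsSigma n)

/-- The model `(T, E)` satisfies the scheme asserting, for every (standard)
`n ∈ ω`, that there is an `n`-baby measurable cardinal `k` with
`V_k ≺_{Σₙ} V`. -/
def Scheme2 (E : T → T → Prop) : Prop :=
  ∀ n : ℕ, ∃ k : T, NBabyMeasurableG E n k ∧
    ∃ v : T, IsVStageG E (· = ·) Set.univ k v ∧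
      ElemG E (· = ·) (SetFormula.IsSigma n) ∅ ∅ {x | E x v} Set.univ

/-- The model `(T, E)` satisfies the scheme asserting, for every (standard)
`n ∈ ω`, that there is an `n`-baby measurable cardinal. -/
def Scheme3 (E : T → T → Prop) : Prop :=
  ∀ n : ℕ, ∃ k : T, NBabyMeasurableG E n k

end BabyMeasurable

namespace BabyMeasurable

/-! ### Definability with parameters over a transitive model of `ZFC⁻` -/

/-- `M` is a transitive model of `ZFC⁻`. -/
structure TransModel (M : ZFSet) : Prop where
  trans : ∀ {x y : ZFSet}, x ∈ M → y ∈ x → y ∈ M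
  zfc : ModelsZFCminusPure (memsOf M)

/-- The predicate `P` on assignments is definable with parameters over `M`. The variables of `P`
may be placed at the positions `s`, the parameters at the positions `r`, and the positions `f`
are available for bound variables. -/
def Dfn (M : ZFSet) (P : (ℕ → ZFSet) → Prop) : Prop :=
  ∃ c : ℕ → ZFSet, (∀ i, c i ∈ M) ∧ ∀ s r f : ℕ → ℕ, Function.Injective f →
    (∀ i j, f i ≠ s j) → (∀ i j, f i ≠ r j) → ∃ φ : SetFormula, φ.PredFree ∧
      ∀ v : ℕ → ZFSet, (∀ k, v k ∈ M) → (∀ i, v (r i) = c i) →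
        (Interp zmem zeq ∅ (memsOf M) φ v ↔ P (fun i => v (s i)))

/-- `t` is a term: a variable or a constant from `M`. -/
def Tm (M : ZFSet) (t : (ℕ → ZFSet) → ZFSet) : Prop :=
  (∃ i, ∀ w, t w = w i) ∨ ∃ c ∈ M, ∀ w, t w = c

theorem Tm.var {M : ZFSet} (i : ℕ) : Tm M (fun w => w i) := Or.inl ⟨i, fun _ => rfl⟩

theorem Tm.const {M c : ZFSet} (hc : c ∈ M) : Tm M (fun _ => c) := Or.inr ⟨c, hc, fun _ => rfl⟩

theorem Tm.lift {M : ZFSet} {t : (ℕ → ZFSet) → ZFSet} (ht : Tm M t) :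
    Tm M (fun w => t (fun i => w (i + 1))) := by
  rcases ht with ⟨i, hi⟩ | ⟨c, hc, h⟩
  · exact Or.inl ⟨i + 1, fun w => hi _⟩
  · exact Or.inr ⟨c, hc, fun w => h _⟩

theorem TransModel.empty_mem {M : ZFSet} (hM : TransModel M) : ∅ ∈ M := by
  obtain ⟨i, hi, ⟨e, he, hei, hemp⟩, -⟩ := hM.zfc.1.2.2.2.1
  have : e = ∅ := by
    rw [ZFSet.eq_empty]
    intro y hy
    exact hemp y (hM.trans he hy) hy
  exact this ▸ he

section
variable {M : ZFSet} {P Q : (ℕ → ZFSet) → Prop}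

theorem Dfn.congr (hP : Dfn M P) (h : ∀ w, (∀ i, w i ∈ M) → (Q w ↔ P w)) : Dfn M Q := by
  obtain ⟨c, hc, H⟩ := hP
  refine ⟨c, hc, fun s r f hf hs hr => ?_⟩
  obtain ⟨φ, hφ, h'⟩ := H s r f hf hs hr
  exact ⟨φ, hφ, fun v hv hvr => (h' v hv hvr).trans (h _ fun i => hv _).symm⟩

theorem Dfn.subst (hP : Dfn M P) {σ : ℕ → (ℕ → ZFSet) → ZFSet} (hσ : ∀ i, Tm M (σ i))
    (hM : TransModel M) : Dfn M (fun w => P (fun i => σ i w)) := by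
  classical
  obtain ⟨c, hc, H⟩ := hP
  have hσ' : ∀ i, ∃ b : Bool, ∃ k : ℕ, ∃ d ∈ M, ∀ w, σ i w = if b then w k else d := by
    intro i
    rcases hσ i with ⟨k, hk⟩ | ⟨d, hd, h⟩
    · exact ⟨true, k, ∅, hM.empty_mem, by simpa using hk⟩
    · exact ⟨false, 0, d, hd, by simpa using h⟩
  choose b k d hd hbk using hσ'
  refine ⟨fun n => if n % 2 = 0 then c (n / 2) else d (n / 2), ?_, fun s r f hf hs hr => ?_⟩
  · intro i
    dsimp only
    split_ifs
    · exact hc _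
    · exact hd _
  obtain ⟨φ, hφ, h'⟩ := H (fun i => if b i then s (k i) else r (2 * i + 1)) (fun i => r (2 * i)) f hf
    (by intro i j; split_ifs; exacts [hs _ _, hr _ _]) (fun i j => hr _ _)
  refine ⟨φ, hφ, fun v hv hvr => ?_⟩
  rw [h' v hv (by intro i; rw [hvr]; simp)]
  have : (fun i => v (if b i then s (k i) else r (2 * i + 1)))
      = fun i => σ i (fun i => v (s i)) := by
    funext i
    rw [hbk]
    split_ifs
    · rfl
    · rw [hvr]
      have h1 : (2 * i + 1) % 2 = 1 := by omega
      have h2 : (2 * i + 1) / 2 = i := by omega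
      simp [h1, h2]
  simp only [this]

theorem Dfn.memVar (hM : TransModel M) : Dfn M (fun w => w 0 ∈ w 1) :=
  ⟨fun _ => ∅, fun _ => hM.empty_mem, fun s r f _ _ _ =>
    ⟨.mem (s 0) (s 1), trivial, fun v _ _ => Iff.rfl⟩⟩

theorem Dfn.eqVar (hM : TransModel M) : Dfn M (fun w => w 0 = w 1) :=
  ⟨fun _ => ∅, fun _ => hM.empty_mem, fun s r f _ _ _ =>
    ⟨.eq (s 0) (s 1), trivial, fun v _ _ => Iff.rfl⟩⟩

theorem Dfn.sub1 (hM : TransModel M) {R : ZFSet → Prop} (hR : Dfn M (fun w => R (w 0)))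
    {t : (ℕ → ZFSet) → ZFSet} (ht : Tm M t) : Dfn M (fun w => R (t w)) :=
  hR.subst (σ := fun _ => t) (fun _ => ht) hM

theorem Dfn.sub2 (hM : TransModel M) {R : ZFSet → ZFSet → Prop}
    (hR : Dfn M (fun w => R (w 0) (w 1)))
    {t u : (ℕ → ZFSet) → ZFSet} (ht : Tm M t) (hu : Tm M u) : Dfn M (fun w => R (t w) (u w)) :=
  hR.subst (σ := fun | 0 => t | _ => u) (by intro i; match i with | 0 => exact ht | _ + 1 => exact hu) hM

theorem Dfn.sub3 (hM : TransModel M) {R : ZFSet → ZFSet → ZFSet → Prop}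
    (hR : Dfn M (fun w => R (w 0) (w 1) (w 2)))
    {t u x : (ℕ → ZFSet) → ZFSet} (ht : Tm M t) (hu : Tm M u) (hx : Tm M x) :
    Dfn M (fun w => R (t w) (u w) (x w)) :=
  hR.subst (σ := fun | 0 => t | 1 => u | _ => x) (by
    intro i; match i with | 0 => exact ht | 1 => exact hu | _ + 2 => exact hx) hM

theorem Dfn.mem (hM : TransModel M) {t u : (ℕ → ZFSet) → ZFSet} (ht : Tm M t) (hu : Tm M u) :
    Dfn M (fun w => t w ∈ u w) :=
  Dfn.sub2 hM (R := fun x y => x ∈ y) (Dfn.memVar hM) ht hu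

theorem Dfn.eq (hM : TransModel M) {t u : (ℕ → ZFSet) → ZFSet} (ht : Tm M t) (hu : Tm M u) :
    Dfn M (fun w => t w = u w) :=
  Dfn.sub2 hM (R := fun x y => x = y) (Dfn.eqVar hM) ht hu

theorem Dfn.not (hP : Dfn M P) : Dfn M (fun w => ¬ P w) := by
  obtain ⟨c, hc, H⟩ := hP
  refine ⟨c, hc, fun s r f hf hs hr => ?_⟩
  obtain ⟨φ, hφ, h'⟩ := H s r f hf hs hr
  exact ⟨.not φ, hφ, fun v hv hvr => not_congr (h' v hv hvr)⟩

theorem Dfn.and (hP : Dfn M P) (hQ : Dfn M Q) : Dfn M (fun w => P w ∧ Q w) := by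
  obtain ⟨c, hc, H⟩ := hP
  obtain ⟨d, hd, K⟩ := hQ
  refine ⟨fun n => if n % 2 = 0 then c (n / 2) else d (n / 2), ?_, fun s r f hf hs hr => ?_⟩
  · intro i
    dsimp only
    split_ifs
    · exact hc _
    · exact hd _
  obtain ⟨φ, hφ, h1⟩ := H s (fun i => r (2 * i)) f hf hs (fun i j => hr _ _)
  obtain ⟨ψ, hψ, h2⟩ := K s (fun i => r (2 * i + 1)) f hf hs (fun i j => hr _ _)
  refine ⟨.and φ ψ, ⟨hφ, hψ⟩, fun v hv hvr => and_congr (h1 v hv ?_) (h2 v hv ?_)⟩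
  · intro i; rw [hvr]; simp
  · intro i; rw [hvr]
    have h1 : (2 * i + 1) % 2 = 1 := by omega
    have h2 : (2 * i + 1) / 2 = i := by omega
    simp [h1, h2]

theorem Dfn.or (hP : Dfn M P) (hQ : Dfn M Q) : Dfn M (fun w => P w ∨ Q w) :=
  (hP.not.and hQ.not).not.congr fun w _ => by tauto

theorem Dfn.imp (hP : Dfn M P) (hQ : Dfn M Q) : Dfn M (fun w => P w → Q w) :=
  (hP.and hQ.not).not.congr fun w _ => by tauto

theorem Dfn.iff (hP : Dfn M P) (hQ : Dfn M Q) : Dfn M (fun w => (P w ↔ Q w)) :=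
  ((hP.imp hQ).and (hQ.imp hP)).congr fun w _ => by tauto

theorem Dfn.all {Q : ZFSet → (ℕ → ZFSet) → Prop}
    (hQ : Dfn M (fun w => Q (w 0) (fun i => w (i + 1)))) : Dfn M (fun w => ∀ x ∈ M, Q x w) := by
  obtain ⟨c, hc, H⟩ := hQ
  refine ⟨c, hc, fun s r f hf hs hr => ?_⟩
  obtain ⟨φ, hφ, h⟩ := H (fun n => Nat.casesOn n (f 0) s) r (fun n => f (n + 1))
    (fun a b hab => by simpa using hf hab)
    (by
      intro i j
      cases j with
      | zero => exact fun h => by simpa using hf h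
      | succ j => exact hs _ _)
    (fun i j => hr _ _)
  refine ⟨.all (f 0) φ, hφ, fun v hv hvr => forall₂_congr fun x hx => ?_⟩
  rw [h]
  · have h1 : ∀ j, Function.update v (f 0) x (s j) = v (s j) := fun j =>
      Function.update_of_ne (hs 0 j).symm _ _
    simp [h1]
  · intro k
    by_cases hk : k = f 0
    · subst hk; simpa using show x ∈ M from hx
    · rw [Function.update_of_ne hk]; exact hv k
  · intro i
    rw [Function.update_of_ne (hr 0 i).symm]; exact hvr i

theorem Dfn.ex {Q : ZFSet → (ℕ → ZFSet) → Prop}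
    (hQ : Dfn M (fun w => Q (w 0) (fun i => w (i + 1)))) : Dfn M (fun w => ∃ x ∈ M, Q x w) :=
  (Dfn.all (Q := fun x w => ¬ Q x w) hQ.not).not.congr fun w _ => by push Not; rfl

theorem Tm.mem_of {t : (ℕ → ZFSet) → ZFSet} (ht : Tm M t) {w : ℕ → ZFSet} (hw : ∀ i, w i ∈ M) :
    t w ∈ M := by
  rcases ht with ⟨i, hi⟩ | ⟨c, hc, h⟩
  · rw [hi]; exact hw i
  · rw [h]; exact hc

theorem Dfn.ball (hM : TransModel M) {t : (ℕ → ZFSet) → ZFSet} (ht : Tm M t)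
    {Q : ZFSet → (ℕ → ZFSet) → Prop}
    (hQ : Dfn M (fun w => Q (w 0) (fun i => w (i + 1)))) : Dfn M (fun w => ∀ x ∈ t w, Q x w) :=
  (Dfn.all (Q := fun x w => x ∈ t w → Q x w)
    ((Dfn.mem hM (Tm.var 0) ht.lift).imp hQ)).congr fun w hw =>
      ⟨fun h x _ hx => h x hx, fun h x hx => h x (hM.trans (ht.mem_of hw) hx) hx⟩

theorem Dfn.bex (hM : TransModel M) {t : (ℕ → ZFSet) → ZFSet} (ht : Tm M t)
    {Q : ZFSet → (ℕ → ZFSet) → Prop}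
    (hQ : Dfn M (fun w => Q (w 0) (fun i => w (i + 1)))) : Dfn M (fun w => ∃ x ∈ t w, Q x w) :=
  (Dfn.ball hM ht (Q := fun x w => ¬ Q x w) hQ.not).not.congr fun w _ => by push Not; rfl

theorem Dfn.subset (hM : TransModel M) {t u : (ℕ → ZFSet) → ZFSet} (ht : Tm M t) (hu : Tm M u) :
    Dfn M (fun w => t w ⊆ u w) :=
  (Dfn.ball hM ht (Q := fun x w => x ∈ u w) (Dfn.mem hM (Tm.var 0) hu.lift)).congr
    fun w _ => Iff.rfl

theorem eq_pair_iff (p x y : ZFSet) : p = ZFSet.pair x y ↔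
    ∃ s ∈ p, ∃ d ∈ p, (x ∈ s ∧ ∀ z ∈ s, z = x) ∧ (x ∈ d ∧ y ∈ d ∧ ∀ z ∈ d, z = x ∨ z = y) ∧
      ∀ z ∈ p, z = s ∨ z = d := by
  constructor
  · rintro rfl
    refine ⟨{x}, ?_, {x, y}, ?_, ?_, ?_, ?_⟩ <;> simp [ZFSet.pair]
  · rintro ⟨s, hs, d, hd, ⟨h1, h2⟩, ⟨h3, h4, h5⟩, h6⟩
    have es : s = {x} := by
      ext z; simp only [ZFSet.mem_singleton]
      exact ⟨h2 z, fun h => h ▸ h1⟩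
    have ed : d = {x, y} := by
      ext z; simp only [ZFSet.mem_pair]
      refine ⟨h5 z, ?_⟩
      rintro (rfl | rfl) <;> assumption
    subst es ed
    ext z
    simp only [ZFSet.pair, ZFSet.mem_pair]
    refine ⟨h6 z, ?_⟩
    rintro (rfl | rfl) <;> assumption

theorem Dfn.eqPair (hM : TransModel M) {t u x : (ℕ → ZFSet) → ZFSet} (ht : Tm M t) (hu : Tm M u)
    (hx : Tm M x) : Dfn M (fun w => t w = ZFSet.pair (u w) (x w)) := by
  refine Dfn.sub3 hM (R := fun p x y => p = ZFSet.pair x y) ?_ ht hu hx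
  simp only [eq_pair_iff]
  refine .bex hM (.var 0) (.bex hM (.var 1) (.and (.and (.mem hM (.var 3) (.var 1))
    (.ball hM (.var 1) (.eq hM (.var 0) (.var 4)))) (.and (.and (.mem hM (.var 3) (.var 0))
    (.and (.mem hM (.var 4) (.var 0)) (.ball hM (.var 0) (.or (.eq hM (.var 0) (.var 4))
    (.eq hM (.var 0) (.var 5)))))) (.ball hM (.var 2) (.or (.eq hM (.var 0) (.var 2))
    (.eq hM (.var 0) (.var 1)))))))

theorem Dfn.pairMem (hM : TransModel M) {t u x : (ℕ → ZFSet) → ZFSet} (ht : Tm M t) (hu : Tm M u)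
    (hx : Tm M x) : Dfn M (fun w => ZFSet.pair (u w) (x w) ∈ t w) :=
  (Dfn.bex hM ht (Q := fun p w => p = ZFSet.pair (u w) (x w))
    (Dfn.eqPair hM (Tm.var 0) hu.lift hx.lift)).congr fun w _ => by simp

end

/-! ### Separation, collection and replacement for definable predicates -/

section
variable {M : ZFSet}

theorem TransModel.sep_mem (hM : TransModel M) {P : ZFSet → Prop} (hP : Dfn M (fun w => P (w 0)))
    {a : ZFSet} (ha : a ∈ M) : ZFSet.sep P a ∈ M := by
  obtain ⟨c, hc, H⟩ := hP
  obtain ⟨φ, hφ, h⟩ := H (fun _ => 0) (fun i => 2 * i + 2) (fun i => 2 * i + 1)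
    (fun i j hij => by simpa using hij) (fun i j => by omega) (fun i j => by omega)
  obtain ⟨b, hb, hbz⟩ := hM.zfc.2.2 φ hφ (fun k => c ((k - 2) / 2)) (fun k => hc _) a ha
  have : b = ZFSet.sep P a := by
    have key : ∀ x ∈ M, x ∈ b ↔ x ∈ a ∧ P x := by
      intro x hx
      refine (hbz x hx).trans (and_congr Iff.rfl ((h _ ?_ ?_).trans ?_))
      · intro k
        by_cases hk : k = 0
        · subst hk; simpa using hx
        · rw [Function.update_of_ne hk]; exact hc _
      · intro i
        rw [Function.update_of_ne (by omega)]
        congr 1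
        omega
      · simp
    ext x
    rw [ZFSet.mem_sep]
    exact ⟨fun hx => (key x (hM.trans hb hx)).1 hx, fun hx => (key x (hM.trans ha hx.1)).2 hx⟩
  exact this ▸ hb

theorem TransModel.collection (hM : TransModel M) {R : ZFSet → ZFSet → Prop}
    (hR : Dfn M (fun w => R (w 0) (w 1))) {a : ZFSet} (ha : a ∈ M)
    (h : ∀ x ∈ a, ∃ y ∈ M, R x y) : ∃ b ∈ M, ∀ x ∈ a, ∃ y ∈ b, R x y := by
  obtain ⟨c, hc, H⟩ := hR
  obtain ⟨φ, hφ, hv⟩ := H (fun i => Nat.casesOn i 0 fun _ => 1) (fun i => 2 * i + 2)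
    (fun i => 2 * i + 3) (fun i j hij => by simpa using hij)
    (fun i j => by cases j <;> simp) (fun i j => by omega)
  have key : ∀ x ∈ M, ∀ y ∈ M, Interp zmem zeq ∅ (memsOf M) φ
      (Function.update (Function.update (fun k => c ((k - 2) / 2)) 0 x) 1 y) ↔ R x y := by
    intro x hx y hy
    refine (hv _ ?_ ?_).trans ?_
    · intro k
      by_cases hk : k = 1
      · subst hk; simpa using hy
      rw [Function.update_of_ne hk]
      by_cases hk : k = 0
      · subst hk; simpa using hx
      · rw [Function.update_of_ne hk]; exact hc _
    · intro i
      rw [Function.update_of_ne (by omega), Function.update_of_ne (by omega)]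
      congr 1
      omega
    · simp
  obtain ⟨b, hb, hbz⟩ := hM.zfc.2.1 φ hφ (fun k => c ((k - 2) / 2)) (fun k => hc _) a ha (by
    intro x hx hxa
    obtain ⟨y, hy, hxy⟩ := h x hxa
    exact ⟨y, hy, (key x hx y hy).2 hxy⟩)
  refine ⟨b, hb, fun x hx => ?_⟩
  obtain ⟨y, hy, hyb, hxy⟩ := hbz x (hM.trans ha hx) hx
  exact ⟨y, hyb, (key x (hM.trans ha hx) y hy).1 hxy⟩

theorem TransModel.upair_mem (hM : TransModel M) {x y : ZFSet} (hx : x ∈ M) (hy : y ∈ M) :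
    ({x, y} : ZFSet) ∈ M := by
  obtain ⟨p, hp, h⟩ := hM.zfc.1.2.1 x hx y hy
  have : p = {x, y} := by
    ext z
    rw [ZFSet.mem_pair]
    refine ⟨fun hz => (h z (hM.trans hp hz)).1 hz, ?_⟩
    rintro (rfl | rfl)
    · exact (h _ hx).2 (Or.inl rfl)
    · exact (h _ hy).2 (Or.inr rfl)
  exact this ▸ hp

theorem TransModel.pair_mem (hM : TransModel M) {x y : ZFSet} (hx : x ∈ M) (hy : y ∈ M) :
    ZFSet.pair x y ∈ M := by
  have := hM.upair_mem hx hx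
  rw [ZFSet.pair_eq_singleton] at this
  exact hM.upair_mem this (hM.upair_mem hx hy)

theorem TransModel.fst_snd_mem (hM : TransModel M) {x y : ZFSet} (h : ZFSet.pair x y ∈ M) :
    x ∈ M ∧ y ∈ M := by
  have h1 : ({x, y} : ZFSet) ∈ M := hM.trans h (by simp [ZFSet.pair])
  exact ⟨hM.trans h1 (by simp), hM.trans h1 (by simp)⟩

theorem TransModel.image_mem (hM : TransModel M) {G : ZFSet → ZFSet}
    (hG : Dfn M (fun w => w 1 = G (w 0))) {a : ZFSet} (ha : a ∈ M) (h : ∀ x ∈ a, G x ∈ M) :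
    ∃ I ∈ M, ∀ y, y ∈ I ↔ ∃ x ∈ a, y = G x := by
  obtain ⟨b, hb, hbz⟩ := hM.collection (R := fun x y => y = G x) hG ha fun x hx => ⟨_, h x hx, rfl⟩
  refine ⟨ZFSet.sep (fun y => ∃ x ∈ a, y = G x) b, hM.sep_mem ?_ hb, fun y => ?_⟩
  · exact .bex hM (.const ha) (Dfn.sub2 hM (R := fun x y => y = G x) hG (.var 0) (.var 1))
  · rw [ZFSet.mem_sep]
    refine ⟨And.right, fun hy => ⟨?_, hy⟩⟩
    obtain ⟨x, hx, rfl⟩ := hy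
    obtain ⟨y, hy, rfl⟩ := hbz x hx
    exact hy

theorem TransModel.graph_mem (hM : TransModel M) {G : ZFSet → ZFSet}
    (hG : Dfn M (fun w => w 1 = G (w 0))) {a : ZFSet} (ha : a ∈ M) (h : ∀ x ∈ a, G x ∈ M) :
    ∃ F ∈ M, ∀ p, p ∈ F ↔ ∃ x ∈ a, p = ZFSet.pair x (G x) := by
  refine hM.image_mem (G := fun x => ZFSet.pair x (G x)) ?_ ha
    fun x hx => hM.pair_mem (hM.trans ha hx) (h x hx)
  have : Dfn M (fun w => ∃ y ∈ M, w 1 = ZFSet.pair (w 0) y ∧ y = G (w 0)) :=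
    .ex (.and (.eqPair hM (.var 2) (.var 1) (.var 0))
      (Dfn.sub2 hM (R := fun x y => y = G x) hG (.var 1) (.var 0)))
  refine this.congr fun w hw => ⟨fun h => ?_, ?_⟩
  · exact ⟨_, (hM.fst_snd_mem (h ▸ hw 1)).2, h, rfl⟩
  · rintro ⟨y, -, h, rfl⟩
    exact h

theorem eq_sep_iff {y a : ZFSet} {P : ZFSet → Prop} :
    y = ZFSet.sep P a ↔ (∀ z ∈ y, z ∈ a ∧ P z) ∧ ∀ z ∈ a, P z → z ∈ y := by
  constructor
  · rintro rfl; simp +contextual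
  · rintro ⟨h1, h2⟩
    ext z
    rw [ZFSet.mem_sep]
    exact ⟨h1 z, fun h => h2 z h.1 h.2⟩

theorem Dfn.eqSep (hM : TransModel M) {Q : ZFSet → ZFSet → Prop}
    (hQ : Dfn M (fun w => Q (w 0) (w 1))) {a : ZFSet} (ha : a ∈ M) :
    Dfn M (fun w => w 1 = ZFSet.sep (Q (w 0)) a) := by
  simp only [eq_sep_iff]
  exact .and (.ball hM (.var 1) (.and (.mem hM (.var 0) (.const ha))
    (.sub2 hM hQ (.var 1) (.var 0)))) (.ball hM (.const ha)
    (.imp (.sub2 hM hQ (.var 1) (.var 0)) (.mem hM (.var 0) (.var 2))))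

/-! ### Absoluteness of elementary notions -/

section
variable {D : Set ZFSet}

theorem oPairG_iff (hD : ∀ x ∈ D, ∀ y ∈ x, y ∈ D)
    {p x y : ZFSet} (hp : p ∈ D) (hx : x ∈ D) (hy : y ∈ D) :
    OPairG zmem zeq D p x y ↔ p = ZFSet.pair x y := by
  rw [eq_pair_iff]
  constructor
  · rintro ⟨s, hs, d, hd, hsp, hdp, h1, h2, h3⟩
    refine ⟨s, hsp, d, hdp, ⟨(h1 x hx).2 (Or.inl rfl), fun z hz => or_self_iff.1
      ((h1 z (hD _ hs _ hz)).1 hz)⟩, ⟨(h2 x hx).2 (Or.inl rfl), (h2 y hy).2 (Or.inr rfl),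
      fun z hz => (h2 z (hD _ hd _ hz)).1 hz⟩, fun z hz => h3 z (hD _ hp _ hz) hz⟩
  · rintro ⟨s, hsp, d, hdp, ⟨h1, h1'⟩, ⟨h2, h2', h2''⟩, h3⟩
    refine ⟨s, hD _ hp _ hsp, d, hD _ hp _ hdp, hsp, hdp, fun z _ => ⟨fun h => Or.inl (h1' z h), ?_⟩,
      fun z _ => ⟨h2'' z, ?_⟩, fun z _ => h3 z⟩
    · rintro (rfl | rfl) <;> assumption
    · rintro (rfl | rfl) <;> assumption

theorem pair_mem_class (hD : ∀ x ∈ D, ∀ y ∈ x, y ∈ D)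
    {x y f : ZFSet} (hf : f ∈ D) (h : ZFSet.pair x y ∈ f) : x ∈ D ∧ y ∈ D := by
  have h1 : ({x, y} : ZFSet) ∈ D := hD _ (hD _ hf _ h) _ (by simp [ZFSet.pair])
  exact ⟨hD _ h1 _ (by simp), hD _ h1 _ (by simp)⟩

theorem appG_iff (hD : ∀ x ∈ D, ∀ y ∈ x, y ∈ D)
    {f x y : ZFSet} (hf : f ∈ D) (hx : x ∈ D) (hy : y ∈ D) :
    AppG zmem zeq D f x y ↔ ZFSet.pair x y ∈ f := by
  constructor
  · rintro ⟨p, hp, hpf, h⟩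
    exact (oPairG_iff hD hp hx hy).1 h ▸ hpf
  · intro h
    exact ⟨_, hD _ hf _ h, h, (oPairG_iff hD (hD _ hf _ h) hx hy).2 rfl⟩

/-- `f` is a function with domain `d`. -/
def IsFn (d f : ZFSet) : Prop :=
  (∀ p ∈ f, ∃ x ∈ d, ∃ y, p = ZFSet.pair x y) ∧ (∀ x ∈ d, ∃ y, ZFSet.pair x y ∈ f) ∧
    ∀ x y y', ZFSet.pair x y ∈ f → ZFSet.pair x y' ∈ f → y = y'

theorem isFuncOnG_iff (hD : ∀ x ∈ D, ∀ y ∈ x, y ∈ D)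
    {d f : ZFSet} (hd : d ∈ D) (hf : f ∈ D) :
    IsFuncOnG zmem zeq D d f ↔ IsFn d f := by
  constructor
  · rintro ⟨h1, h2, h3⟩
    have h1' : ∀ p ∈ f, ∃ x ∈ d, ∃ y, p = ZFSet.pair x y := by
      intro p hp
      obtain ⟨x, hx, hxd, y, hy, hxy⟩ := h1 p (hD _ hf _ hp) hp
      exact ⟨x, hxd, y, (oPairG_iff hD (hD _ hf _ hp) hx hy).1 hxy⟩
    refine ⟨h1', fun x hx => ?_, fun x y y' hy hy' => ?_⟩
    · obtain ⟨y, hy, hxy⟩ := h2 x (hD _ hd _ hx) hx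
      exact ⟨y, (appG_iff hD hf (hD _ hd _ hx) hy).1 hxy⟩
    · obtain ⟨x', hx', z, hz⟩ := h1' _ hy
      obtain ⟨rfl, rfl⟩ := ZFSet.pair_inj.1 hz
      have a := pair_mem_class hD hf hy
      have b := pair_mem_class hD hf hy'
      exact h3 x a.1 hx' y a.2 y' b.2 ((appG_iff hD hf a.1 a.2).2 hy) ((appG_iff hD hf b.1 b.2).2 hy')
  · rintro ⟨h1, h2, h3⟩
    refine ⟨fun p hp hpf => ?_, fun x hx hxd => ?_, fun x hx hxd y hy y' hy' h h' => ?_⟩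
    · obtain ⟨x, hx, y, rfl⟩ := h1 p hpf
      have a := pair_mem_class hD hf hpf
      exact ⟨x, a.1, hx, y, a.2, (oPairG_iff hD hp a.1 a.2).2 rfl⟩
    · obtain ⟨y, hy⟩ := h2 x hxd
      have a := pair_mem_class hD hf hy
      exact ⟨y, a.2, (appG_iff hD hf a.1 a.2).2 hy⟩
    · exact h3 x y y' ((appG_iff hD hf hx hy).1 h) ((appG_iff hD hf hx hy').1 h')

theorem isBijFunG_iff (hD : ∀ x ∈ D, ∀ y ∈ x, y ∈ D)
    {d r f : ZFSet} (hd : d ∈ D) (hr : r ∈ D) (hf : f ∈ D) :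
    IsBijFunG zmem zeq D d r f ↔ IsFn d f ∧ (∀ x y, ZFSet.pair x y ∈ f → y ∈ r) ∧
      (∀ x x' y, ZFSet.pair x y ∈ f → ZFSet.pair x' y ∈ f → x = x') ∧
      ∀ y ∈ r, ∃ x ∈ d, ZFSet.pair x y ∈ f := by
  simp only [IsBijFunG, IsInjFunG, isFuncOnG_iff hD hd hf, and_assoc]
  refine and_congr Iff.rfl (and_congr ?_ (and_congr ?_ ?_))
  · refine ⟨fun h x y hxy => ?_, fun h x hx y hy hxy => h x y ((appG_iff hD hf hx hy).1 hxy)⟩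
    have a := pair_mem_class hD hf hxy
    exact h x a.1 y a.2 ((appG_iff hD hf a.1 a.2).2 hxy)
  · refine ⟨fun h x x' y hx hx' => ?_, ?_⟩
    · have a := pair_mem_class hD hf hx
      have b := pair_mem_class hD hf hx'
      exact h x a.1 x' b.1 y a.2 y a.2 ((appG_iff hD hf a.1 a.2).2 hx)
        ((appG_iff hD hf b.1 b.2).2 hx') rfl
    · rintro h x hx x' hx' y hy _ hy' h1 h2 rfl
      exact h x x' y ((appG_iff hD hf hx hy).1 h1) ((appG_iff hD hf hx' hy).1 h2)
  · refine ⟨fun h y hy => ?_, fun h y hy hyr => ?_⟩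
    · obtain ⟨x, hx, hxd, hxy⟩ := h y (hD _ hr _ hy) hy
      exact ⟨x, hxd, (appG_iff hD hf hx (hD _ hr _ hy)).1 hxy⟩
    · obtain ⟨x, hx, hxy⟩ := h y hyr
      exact ⟨x, hD _ hd _ hx, hx, (appG_iff hD hf (hD _ hd _ hx) hy).2 hxy⟩

end

theorem zApp_iff {f x y : ZFSet} : ZApp f x y ↔ ZFSet.pair x y ∈ f :=
  appG_iff (D := Set.univ) (fun _ _ _ _ => trivial) trivial trivial trivial

theorem zIsFuncOn_iff {d f : ZFSet} : ZIsFuncOn d f ↔ IsFn d f :=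
  isFuncOnG_iff (D := Set.univ) (fun _ _ _ _ => trivial) trivial trivial

theorem isOrdG_iff {D : Set ZFSet} (hD : ∀ x ∈ D, ∀ y ∈ x, y ∈ D) {o : ZFSet} (ho : o ∈ D) :
    IsOrdG zmem zeq D o ↔ o.IsOrdinal := by
  constructor
  · rintro ⟨h1, h2, h3⟩
    refine ZFSet.isOrdinal_iff_forall_mem_isTransitive.2 ⟨fun x hx y hy => ?_, fun x hx y hy z hz => ?_⟩
    · exact h1 x (hD _ ho _ hx) hx y (hD _ (hD _ ho _ hx) _ hy) hy
    · have hx' := hD _ ho _ hx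
      have hy' := hD _ hx' _ hy
      exact h2 x hx' hx y hy' hy z (hD _ hy' _ hz) hz
  · intro h
    refine ⟨fun x _ hx y _ hy => h.mem_trans hy hx, fun x _ hx y _ hy z _ hz =>
      (h.mem hx).mem_trans hz hy, fun x _ hx y _ hy => (h.mem hx).mem_trichotomous (h.mem hy)⟩

theorem zIsOrd_iff {o : ZFSet} : ZIsOrd o ↔ o.IsOrdinal :=
  isOrdG_iff (D := Set.univ) (fun _ _ _ _ => trivial) trivial

end

/-! ### Cardinals among the von Neumann ordinals -/

theorem card_le_of_rel {a b : ZFSet} {R : ZFSet → ZFSet → Prop} (h1 : ∀ x ∈ a, ∃ y ∈ b, R x y)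
    (h2 : ∀ x x' y, R x y → R x' y → x = x') : a.card ≤ b.card := by
  have h1' : ∀ x : a, ∃ y : b, R x y := fun x =>
    let ⟨y, hy, h⟩ := h1 x x.2
    ⟨⟨y, hy⟩, h⟩
  choose g hg using h1'
  have : Cardinal.mk a ≤ Cardinal.mk b := Cardinal.mk_le_of_injective (f := g) fun x x' hxx =>
    Subtype.ext (h2 _ _ _ (hg x) (hxx ▸ hg x'))
  rwa [ZFSet.cardinalMk_coe_sort, ZFSet.cardinalMk_coe_sort, Cardinal.lift_le] at this

theorem zIsBijFun_iff {d r f : ZFSet} :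
    ZIsBijFun d r f ↔ IsFn d f ∧ (∀ x y, ZFSet.pair x y ∈ f → y ∈ r) ∧
      (∀ x x' y, ZFSet.pair x y ∈ f → ZFSet.pair x' y ∈ f → x = x') ∧
      ∀ y ∈ r, ∃ x ∈ d, ZFSet.pair x y ∈ f :=
  isBijFunG_iff (D := Set.univ) (fun _ _ _ _ => trivial) trivial trivial trivial

theorem exists_zIsBijFun {a b : ZFSet} (h : a.card = b.card) : ∃ f, ZIsBijFun a b f := by
  have h' : Cardinal.mk a = Cardinal.mk b := by
    rw [ZFSet.cardinalMk_coe_sort, ZFSet.cardinalMk_coe_sort, h]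
  obtain ⟨e⟩ := Cardinal.eq.1 h'
  let f : ZFSet := ZFSet.sep (fun p => ∃ x : a, p = ZFSet.pair x (e x)) (ZFSet.prod a b)
  have hf : ∀ x y, ZFSet.pair x y ∈ f ↔ ∃ hx : x ∈ a, y = e ⟨x, hx⟩ := by
    intro x y
    simp only [f, ZFSet.mem_sep, ZFSet.pair_mem_prod, ZFSet.pair_inj]
    constructor
    · rintro ⟨-, ⟨z, hz⟩, rfl, rfl⟩; exact ⟨hz, rfl⟩
    · rintro ⟨h, rfl⟩; exact ⟨⟨h, (e _).2⟩, ⟨x, h⟩, rfl, rfl⟩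
  refine ⟨f, zIsBijFun_iff.2 ⟨⟨fun p hp => ?_, fun x hx => ⟨_, (hf _ _).2 ⟨hx, rfl⟩⟩, ?_⟩, ?_, ?_, ?_⟩⟩
  · obtain ⟨x, rfl⟩ := (ZFSet.mem_sep.1 hp).2
    exact ⟨x, x.2, _, rfl⟩
  · intro x y y' h1 h2
    obtain ⟨_, rfl⟩ := (hf _ _).1 h1
    obtain ⟨_, rfl⟩ := (hf _ _).1 h2
    rfl
  · intro x y h1
    obtain ⟨_, rfl⟩ := (hf _ _).1 h1
    exact (e _).2
  · intro x x' y h1 h2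
    obtain ⟨hx, h1⟩ := (hf _ _).1 h1
    obtain ⟨hx', h2⟩ := (hf _ _).1 h2
    simpa using e.injective (Subtype.ext (h1.symm.trans h2))
  · intro y hy
    exact ⟨e.symm ⟨y, hy⟩, (e.symm _).2, (hf _ _).2 ⟨(e.symm _).2, by simp⟩⟩

theorem zIsCard_iff {c : ZFSet} : ZIsCard c ↔ c.IsOrdinal ∧ ∀ o ∈ c, o.card < c.card := by
  refine and_congr_left_iff.2 (fun _ => Iff.rfl) |>.trans (and_congr_left fun _ => zIsOrd_iff) |>.trans
    (and_congr_right fun hc => ⟨fun h o ho => ?_, fun h o _ ho f _ hf => ?_⟩)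
  · refine (ZFSet.card_mono (hc.subset_of_mem ho)).lt_of_ne fun he => ?_
    obtain ⟨f, hf⟩ := exists_zIsBijFun he
    exact h o trivial ho f trivial hf
  · obtain ⟨⟨h1, h2, h3⟩, h4, h5, h6⟩ := zIsBijFun_iff.1 hf
    refine (h o ho).ne (le_antisymm ?_ ?_)
    · exact card_le_of_rel (R := fun x y => ZFSet.pair x y ∈ f)
        (fun x hx => (h2 x hx).imp fun y hy => ⟨h4 _ _ hy, hy⟩) h5
    · exact card_le_of_rel (R := fun y x => ZFSet.pair x y ∈ f) h6 fun y y' x => h3 x y y'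

theorem ZIsCard.isOrdinal {c : ZFSet} (hc : ZIsCard c) : c.IsOrdinal := (zIsCard_iff.1 hc).1

theorem zIsCard_of_limit {ν : ZFSet} (hν : ν.IsOrdinal)
    (h : ∀ β ∈ ν, ∃ c ∈ ν, β ∈ c ∧ ZIsCard c) : ZIsCard ν := by
  refine zIsCard_iff.2 ⟨hν, fun o ho => ?_⟩
  obtain ⟨c, hc, hoc, hcc⟩ := h o ho
  exact ((zIsCard_iff.1 hcc).2 o hoc).trans_le (ZFSet.card_mono (hν.subset_of_mem hc))

theorem exists_card_mem {κ β : ZFSet} (hκ : ZIsInacc κ) (hβ : β ∈ κ) :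
    ∃ c ∈ κ, β ∈ c ∧ ZIsCard c := by
  have hord : κ.IsOrdinal := ZIsCard.isOrdinal hκ.1
  have h1 : ∃ c, c ∈ κ ∧ β.card < c.card := by
    obtain ⟨p, -, hp, c, -, hc, f, -, ⟨hf, hfr, hfi⟩⟩ := hκ.2.2.2 β trivial hβ
    refine ⟨c, hc, ?_⟩
    have hp' : p = ZFSet.powerset β := by
      ext z
      rw [ZFSet.mem_powerset]
      exact (hp z trivial).trans ⟨fun h x hx => h x trivial hx, fun h x _ hx => h hx⟩
    have hf' := zIsFuncOn_iff.1 hf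
    calc β.card < 2 ^ β.card := Cardinal.cantor _
      _ = p.card := by rw [hp', ZFSet.card_powerset]
      _ ≤ c.card := card_le_of_rel (R := fun x y => ZFSet.pair x y ∈ f)
        (fun x hx => (hf'.2.1 x hx).imp fun y hy => ⟨hfr x trivial y trivial (zApp_iff.2 hy), hy⟩)
        (fun x x' y h h' => hfi x trivial x' trivial y trivial y trivial (zApp_iff.2 h)
          (zApp_iff.2 h') rfl)
  obtain ⟨c, ⟨hc, hbc⟩, hmin⟩ := ZFSet.mem_wf.has_min {c | c ∈ κ ∧ β.card < c.card} h1
  have hco := hord.mem hc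
  refine ⟨c, hc, ?_, zIsCard_iff.2 ⟨hco, fun o ho => ?_⟩⟩
  · exact ((hco.not_subset_iff_mem (hord.mem hβ)).1 fun h => (ZFSet.card_mono h).not_gt hbc)
  · have := hmin o
    by_contra hlt
    exact this ⟨hord.mem_trans ho hc, hbc.trans_le (not_lt.1 hlt)⟩ ho

/-! ### Ordinal addition -/

/-- The ordinal sum `α + β`. -/
noncomputable def oadd (α β : ZFSet) : ZFSet := (α.rank + β.rank).toZFSet

theorem isOrdinal_oadd (α β : ZFSet) : (oadd α β).IsOrdinal := ZFSet.isOrdinal_toZFSet _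

theorem mem_oadd {α β z : ZFSet} (hα : α.IsOrdinal) (hβ : β.IsOrdinal) :
    z ∈ oadd α β ↔ z ∈ α ∨ ∃ γ ∈ β, z = oadd α γ := by
  rw [oadd, Ordinal.mem_toZFSet_iff]
  constructor
  · rintro ⟨a, ha, rfl⟩
    rcases lt_or_ge a α.rank with h | h
    · left
      rw [← hα.toZFSet_rank_eq]
      exact Ordinal.toZFSet_mem_toZFSet_iff.2 h
    · right
      obtain ⟨b, rfl⟩ := exists_add_of_le h
      refine ⟨b.toZFSet, ?_, ?_⟩
      · rw [← hβ.toZFSet_rank_eq]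
        exact Ordinal.toZFSet_mem_toZFSet_iff.2 (lt_of_add_lt_add_left ha)
      · rw [oadd, Ordinal.rank_toZFSet]
  · rintro (h | ⟨γ, hγ, rfl⟩)
    · exact ⟨z.rank, (ZFSet.rank_lt_of_mem h).trans_le le_self_add, (hα.mem h).toZFSet_rank_eq⟩
    · exact ⟨_, by simpa using ZFSet.rank_lt_of_mem hγ, rfl⟩

theorem oadd_mem_oadd {α β γ : ZFSet} (h : γ ∈ β) : oadd α γ ∈ oadd α β :=
  Ordinal.toZFSet_mem_toZFSet_iff.2 (by simpa using ZFSet.rank_lt_of_mem h)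

/-- For ordinals closed under doubling, the representation `α + β` with `β < α` is unique. -/
theorem oadd_inj {α α' β β' : ZFSet} (hα : α.IsOrdinal) (hα' : α'.IsOrdinal)
    (hc : ∀ γ ∈ α, oadd γ γ ∈ α) (hc' : ∀ γ ∈ α', oadd γ γ ∈ α')
    (hβ : β ∈ α) (hβ' : β' ∈ α') (h : oadd α β = oadd α' β') : α = α' ∧ β = β' := by
  have key : ∀ {α α' β β' : ZFSet}, α.IsOrdinal → α'.IsOrdinal → (∀ γ ∈ α', oadd γ γ ∈ α') →
      β ∈ α → oadd α β = oadd α' β' → α ∉ α' := by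
    intro α α' β β' hα hα' hc' hβ h hlt
    have h1 := hc' α hlt
    have h2 : (oadd α β).rank < α'.rank :=
      lt_trans (by simpa [oadd] using ZFSet.rank_lt_of_mem hβ) (ZFSet.rank_lt_of_mem h1)
    rw [h] at h2
    simp [oadd] at h2
  have e : α = α' := by
    rcases hα.mem_trichotomous hα' with h' | h' | h'
    · exact absurd h' (key hα hα' hc' hβ h)
    · exact h'
    · exact absurd h' (key hα' hα hc hβ' h.symm)
  subst e
  refine ⟨rfl, ((hα.mem hβ).rank_inj (hα.mem hβ')).1 ?_⟩
  simpa [oadd, Ordinal.toZFSet_injective.eq_iff] using h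

theorem oadd_mem {κ : ZFSet} (hκ : ZIsInacc κ) {α : ZFSet} (hα : α ∈ κ) :
    ∀ β : ZFSet, β ∈ κ → oadd α β ∈ κ := by
  have hord : κ.IsOrdinal := ZIsCard.isOrdinal hκ.1
  intro β
  induction β using ZFSet.inductionOn with
  | _ β ih =>
  intro hβ
  have hr : ∀ γ ∈ β, oadd α γ ∈ κ := fun γ hγ => ih γ hγ (hord.mem_trans hγ hβ)
  let f : ZFSet := ZFSet.sep (fun p => ∃ γ ∈ β, p = ZFSet.pair γ (oadd α γ)) (ZFSet.prod β κ)
  have hf : ∀ γ y, ZFSet.pair γ y ∈ f ↔ γ ∈ β ∧ y = oadd α γ := by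
    intro γ y
    simp only [f, ZFSet.mem_sep, ZFSet.pair_mem_prod, ZFSet.pair_inj]
    constructor
    · rintro ⟨-, γ', h, rfl, rfl⟩; exact ⟨h, rfl⟩
    · rintro ⟨h, rfl⟩; exact ⟨⟨h, hr _ h⟩, γ, h, rfl, rfl⟩
  obtain ⟨b, -, hb, hbb⟩ := hκ.2.2.1 β trivial hβ f trivial
    ((zIsFuncOn_iff (d := β) (f := f)).2 ⟨fun p hp => by
      obtain ⟨γ, h, rfl⟩ := (ZFSet.mem_sep.1 hp).2; exact ⟨γ, h, _, rfl⟩,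
      fun x hx => ⟨_, (hf _ _).2 ⟨hx, rfl⟩⟩,
      fun x y y' h h' => ((hf _ _).1 h).2.trans ((hf _ _).1 h').2.symm⟩)
    (fun x _ y _ hxy => by
      obtain ⟨h, rfl⟩ := (hf _ _).1 ((zApp_iff).1 hxy); exact hr _ h)
  have hb' : ∀ γ ∈ β, oadd α γ ∈ b := fun γ hγ =>
    hbb γ trivial _ trivial (zApp_iff.2 ((hf _ _).2 ⟨hγ, rfl⟩))
  have hαo := hord.mem hα
  have hbo := hord.mem hb
  obtain ⟨m, hm, hαm, hbm⟩ : ∃ m ∈ κ, α ⊆ m ∧ b ⊆ m := by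
    rcases hαo.mem_trichotomous hbo with h | h | h
    · exact ⟨b, hb, hbo.subset_of_mem h, fun _ => id⟩
    · exact ⟨b, hb, h ▸ fun _ => id, fun _ => id⟩
    · exact ⟨α, hα, fun _ => id, hαo.subset_of_mem h⟩
  refine (isOrdinal_oadd α β).mem_of_subset_of_mem hord (y := m) ?_ hm
  intro z hz
  rcases (mem_oadd hαo (hord.mem hβ)).1 hz with h | ⟨γ, hγ, rfl⟩
  · exact hαm h
  · exact hbm (hb' γ hγ)

/-! ### Weak `κ`-models with weakly amenable ultrafilters -/

/-- The facts used about a weak `κ`-model `M` with `v = V_κ` and a weakly amenable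
`M`-ultrafilter `U`. -/
structure UltraModel (κ M v : ZFSet) (U : Set ZFSet) : Prop where
  model : TransModel M
  inacc : ZIsInacc κ
  card_mem : κ ∈ M
  stage_mem : v ∈ M
  subset_mem_stage : ∀ ξ ∈ κ, ∀ x : ZFSet, x ⊆ ξ → x ∈ v
  rel_mem_stage : ∀ ξ ∈ κ, ∀ r : ZFSet, r ⊆ ZFSet.prod ξ ξ → r ∈ v
  mem_model : ∀ A ∈ U, A ∈ M
  upward : ∀ A ∈ U, ∀ B ∈ M, A ⊆ B → B ⊆ κ → B ∈ U
  inter : ∀ A ∈ U, ∀ B ∈ U, A ∩ B ∈ U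
  nonempty : ∀ A ∈ U, ∃ z, z ∈ A
  ultra : ∀ A ∈ M, A ⊆ κ → A ∈ U ∨ ZFSet.sep (· ∉ A) κ ∈ U
  tail : ∀ ξ ∈ κ, ZFSet.sep (ξ ∈ ·) κ ∈ U
  diag : ∀ F ∈ M, IsFn κ F → (∀ ξ y, ZFSet.pair ξ y ∈ F → y ∈ U) →
    ZFSet.sep (fun β => ∀ ξ ∈ β, ∀ y, ZFSet.pair ξ y ∈ F → β ∈ y) κ ∈ U
  amenable : ∀ I ∈ M, (∃ f ∈ M, ZIsBijFun κ I f) → ∃ c ∈ M, ∀ z, z ∈ c ↔ z ∈ I ∧ z ∈ U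
  wellOrder : ∃ o ∈ M, o.IsOrdinal ∧ ∃ f ∈ M, ZIsBijFun o v f

theorem isVStage_facts {κ v : ZFSet} (hκ : κ.IsOrdinal) (hlim : ∀ ξ ∈ κ, ∃ η ∈ κ, ξ ∈ η)
    (hv : ZIsVStage κ v) : (∀ ξ ∈ κ, ∀ x : ZFSet, x ⊆ ξ → x ∈ v) ∧
      ∀ ξ ∈ κ, ∀ r : ZFSet, r ⊆ ZFSet.prod ξ ξ → r ∈ v := by
  obtain ⟨h, -, hfn, hrec, hvz⟩ := hv
  have hfn' := zIsFuncOn_iff.1 hfn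
  choose H hH using hfn'.2.1
  have hstage : ∀ ξ (hξ : ξ ∈ κ) z, z ∈ H ξ hξ ↔ ∃ η, ∃ hη : η ∈ κ, η ∈ ξ ∧ z ⊆ H η hη := by
    intro ξ hξ z
    refine (hrec ξ trivial hξ _ trivial (zApp_iff.2 (hH ξ hξ)) z trivial).trans ⟨?_, ?_⟩
    · rintro ⟨η, -, hη, w, -, hw, hz⟩
      have hηκ := hκ.mem_trans hη hξ
      refine ⟨η, hηκ, hη, fun x hx => ?_⟩
      rw [← hfn'.2.2 _ _ _ (zApp_iff.1 hw) (hH η hηκ)]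
      exact hz x trivial hx
    · rintro ⟨η, hηκ, hη, hz⟩
      exact ⟨η, trivial, hη, _, trivial, zApp_iff.2 (hH η hηκ), fun x _ hx => hz hx⟩
  have hv' : ∀ ξ (hξ : ξ ∈ κ) z, z ⊆ H ξ hξ → z ∈ v := by
    intro ξ hξ z hz
    obtain ⟨η, hη, hξη⟩ := hlim ξ hξ
    exact (hvz z trivial).2 ⟨η, trivial, hη, _, trivial, zApp_iff.2 (hH η hη),
      (hstage η hη z).2 ⟨ξ, hξ, hξη, hz⟩⟩
  have hself : ∀ ξ (hξ : ξ ∈ κ), ξ ⊆ H ξ hξ := by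
    intro ξ
    induction ξ using ZFSet.inductionOn with
    | _ ξ ih =>
    intro hξ η hη
    exact (hstage ξ hξ η).2 ⟨η, hκ.mem_trans hη hξ, hη, ih η hη _⟩
  refine ⟨fun ξ hξ x hx => hv' ξ hξ x fun y hy => hself ξ hξ (hx hy), fun ξ hξ r hr => ?_⟩
  obtain ⟨η, hη, hξη⟩ := hlim ξ hξ
  obtain ⟨ζ, hζ, hηζ⟩ := hlim η hη
  refine hv' ζ hζ r fun p hp => ?_
  obtain ⟨a, ha, b, hb, rfl⟩ := ZFSet.mem_prod.1 (hr hp)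
  refine (hstage ζ hζ _).2 ⟨η, hη, hηζ, fun z hz => (hstage η hη z).2 ⟨ξ, hξ, hξη, fun x hx => ?_⟩⟩
  rw [ZFSet.pair, ZFSet.mem_pair] at hz
  refine hself ξ hξ ?_
  rcases hz with rfl | rfl
  · rw [ZFSet.mem_singleton] at hx; exact hx ▸ ha
  · rcases ZFSet.mem_pair.1 hx with rfl | rfl <;> assumption

theorem exists_ultraModel {κ M : ZFSet} {U : Set ZFSet} (hM : IsWeakKappaModel κ M)
    (hU : IsMUltrafilter κ M U) (hW : WeaklyAmenable κ M U) : ∃ v, UltraModel κ M v U := by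
  obtain ⟨hκ, htr, -, ⟨v, hvM, hv⟩, hzfc⟩ := hM
  obtain ⟨u1, u2, u3, u4, u5, u6, u7, u8⟩ := hU
  have T : TransModel M := ⟨fun hx hy => htr _ trivial hx _ trivial hy, hzfc⟩
  have hD : ∀ x ∈ memsOf M, ∀ y ∈ x, y ∈ memsOf M := fun x hx y hy => T.trans hx hy
  have hord : κ.IsOrdinal := ZIsCard.isOrdinal hκ.1
  have hlim : ∀ ξ ∈ κ, ∃ η ∈ κ, ξ ∈ η := by
    intro ξ hξ
    obtain ⟨c, hc, h, -⟩ := exists_card_mem hκ hξ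
    exact ⟨c, hc, h⟩
  obtain ⟨v1, v2⟩ := isVStage_facts hord hlim hv
  have hκM : ∀ ξ ∈ κ, ξ ∈ M := fun ξ hξ => T.trans hvM (v1 ξ hξ ξ fun _ => id)
  have extM : ∀ A B : ZFSet, A ∈ M → (∀ z ∈ B, z ∈ M) → (∀ z ∈ M, z ∈ A ↔ z ∈ B) → A = B := by
    intro A B hA hB h
    ext z
    exact ⟨fun hz => (h z (T.trans hA hz)).1 hz, fun hz => (h z (hB z hz)).2 hz⟩
  have memM : ∀ A ∈ U, A ∈ M := fun A hA => (u1 A hA).1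
  have card_mem : κ ∈ M := by
    obtain ⟨a, ha, h⟩ := u2
    exact extM a κ (memM a ha) hκM h ▸ memM a ha
  refine ⟨v, ⟨T, hκ, card_mem, hvM, v1, v2, memM, fun A hA B hB h h' => u3 A hA B hB (fun x _ hx => h hx)
    (fun x _ hx => h' hx), fun A hA B hB => ?_, fun A hA => (u5 A hA).imp fun _ => And.right,
    fun A hA h => (u6 A hA fun x _ hx => h hx).imp id ?_, fun ξ hξ => ?_, fun F hF hFn hFU => ?_,
    fun I hI => ?_, ?_⟩⟩
  · obtain ⟨c, hc, h⟩ := u4 A hA B hB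
    refine extM c (A ∩ B) (memM c hc) (fun z hz => T.trans (memM A hA) (ZFSet.mem_inter.1 hz).1)
      (fun z hz => (h z hz).trans ZFSet.mem_inter.symm) ▸ hc
  · rintro ⟨c, hc, h⟩
    exact extM c (ZFSet.sep (· ∉ A) κ) (memM c hc) (fun z hz => hκM z (ZFSet.mem_sep.1 hz).1)
      (fun z hz => (h z hz).trans (ZFSet.mem_sep (p := (· ∉ A))).symm) ▸ hc
  · obtain ⟨c, hc, h⟩ := u7 ξ (hκM ξ hξ) hξ
    exact extM c _ (memM c hc) (fun z hz => hκM z (ZFSet.mem_sep.1 hz).1)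
      (fun z hz => (h z hz).trans ZFSet.mem_sep.symm) ▸ hc
  · obtain ⟨c, hc, h⟩ := u8 F hF ((isFuncOnG_iff hD card_mem hF).2 hFn) (fun ξ hξ _ y hy hxy =>
      hFU ξ y ((appG_iff hD hF hξ hy).1 hxy))
    refine extM c _ (memM c hc) (fun z hz => hκM z (ZFSet.mem_sep.1 hz).1)
      (fun z hz => (h z hz).trans ((and_congr_right fun hzκ => ?_).trans ZFSet.mem_sep.symm)) ▸ hc
    constructor
    · intro h ξ hξ y hy
      have a := pair_mem_class hD hF hy
      exact h ξ a.1 hξ y a.2 ((appG_iff hD hF a.1 a.2).2 hy)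
    · intro h ξ hξM hξ y hy hxy
      exact h ξ hξ y ((appG_iff hD hF hξM hy).1 hxy)
  · rintro ⟨f, hf, hb⟩
    obtain ⟨c, hc, h⟩ := hW I hI ⟨f, hf, hb⟩
    exact ⟨c, hc, fun z => h z trivial⟩
  · obtain ⟨o, ho, hoo, f, hf, hb⟩ := hzfc.1.2.2.2.2.2 v hvM
    exact ⟨o, ho, (isOrdG_iff hD ho).1 hoo, f, hf,
      zIsBijFun_iff.2 ((isBijFunG_iff hD ho hvM hf).1 hb)⟩

/-- `P` holds for all members of some set in `U`. -/
def Many (U : Set ZFSet) (P : ZFSet → Prop) : Prop := ∃ X ∈ U, ∀ ν ∈ X, P ν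

namespace UltraModel
variable {κ M v : ZFSet} {U : Set ZFSet} {P Q : ZFSet → Prop}

theorem isOrdinal (S : UltraModel κ M v U) : κ.IsOrdinal := ZIsCard.isOrdinal S.inacc.1

theorem many_and (S : UltraModel κ M v U) (hP : Many U P) (hQ : Many U Q) :
    Many U (fun ν => P ν ∧ Q ν) := by
  obtain ⟨X, hX, h⟩ := hP
  obtain ⟨Y, hY, h'⟩ := hQ
  exact ⟨_, S.inter X hX Y hY, fun ν hν =>
    ⟨h ν (ZFSet.mem_inter.1 hν).1, h' ν (ZFSet.mem_inter.1 hν).2⟩⟩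

theorem many_mono (hP : Many U P) (h : ∀ ν, P ν → Q ν) : Many U Q := by
  obtain ⟨X, hX, h'⟩ := hP
  exact ⟨X, hX, fun ν hν => h ν (h' ν hν)⟩

theorem many_exists (S : UltraModel κ M v U) (hP : Many U P) {ξ : ZFSet} (hξ : ξ ∈ κ) :
    ∃ ν ∈ κ, ξ ∈ ν ∧ P ν := by
  obtain ⟨X, hX, h⟩ := hP
  obtain ⟨ν, hν⟩ := S.nonempty _ (S.inter X hX _ (S.tail ξ hξ))
  obtain ⟨h1, h2⟩ := ZFSet.mem_inter.1 hν
  exact ⟨ν, (ZFSet.mem_sep.1 h2).1, (ZFSet.mem_sep.1 h2).2, h ν h1⟩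

theorem many_or_not (S : UltraModel κ M v U) (hP : Dfn M (fun w => P (w 0))) :
    Many U P ∨ Many U (fun ν => ¬ P ν) := by
  refine (S.ultra _ (S.model.sep_mem hP S.card_mem) fun z hz => (ZFSet.mem_sep.1 hz).1).imp
    (fun h => ⟨_, h, fun ν hν => (ZFSet.mem_sep.1 hν).2⟩) fun h => ⟨_, h, fun ν hν hP => ?_⟩
  obtain ⟨h1, h2⟩ := ZFSet.mem_sep.1 hν
  exact h2 (ZFSet.mem_sep.2 ⟨h1, hP⟩)

theorem many_diag (S : UltraModel κ M v U) {T : ZFSet → ZFSet → Prop}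
    (hT : Dfn M (fun w => T (w 0) (w 1))) (h : ∀ β ∈ κ, ZFSet.sep (T β) κ ∈ U) :
    Many U (fun ν => ν ∈ κ ∧ ∀ β ∈ ν, T β ν) := by
  obtain ⟨F, hF, hFm⟩ := S.model.graph_mem (G := fun β => ZFSet.sep (T β) κ)
    (Dfn.eqSep S.model hT S.card_mem) S.card_mem fun β hβ => S.mem_model _ (h β hβ)
  have hFp : ∀ β y, ZFSet.pair β y ∈ F ↔ β ∈ κ ∧ y = ZFSet.sep (T β) κ := by
    intro β y
    rw [hFm]
    constructor
    · rintro ⟨x, hx, he⟩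
      obtain ⟨rfl, rfl⟩ := ZFSet.pair_inj.1 he
      exact ⟨hx, rfl⟩
    · rintro ⟨hx, rfl⟩
      exact ⟨β, hx, rfl⟩
  refine ⟨_, S.diag F hF ⟨fun p hp => ?_, fun x hx => ⟨_, (hFp _ _).2 ⟨hx, rfl⟩⟩,
    fun x y y' h h' => ((hFp _ _).1 h).2.trans ((hFp _ _).1 h').2.symm⟩ (fun ξ y hy => ?_),
    fun ν hν => ?_⟩
  · obtain ⟨x, hx, rfl⟩ := (hFm p).1 hp
    exact ⟨x, hx, _, rfl⟩
  · obtain ⟨hξ, rfl⟩ := (hFp _ _).1 hy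
    exact h ξ hξ
  · obtain ⟨h1, h2⟩ := ZFSet.mem_sep.1 hν
    exact ⟨h1, fun β hβ => (ZFSet.mem_sep.1 (h2 β hβ _
      ((hFp _ _).2 ⟨S.isOrdinal.mem_trans hβ h1, rfl⟩))).2⟩

/-- A relation that holds for each `β` at all large enough `ν` holds for all `β < ν`, for
`U`-many `ν`. -/
theorem many_forall_mem (S : UltraModel κ M v U) {T : ZFSet → ZFSet → Prop}
    (hT : Dfn M (fun w => T (w 0) (w 1)))
    (h : ∀ β ∈ κ, ∃ γ ∈ κ, ∀ ν ∈ κ, γ ∈ ν → T β ν) :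
    Many U (fun ν => ν ∈ κ ∧ ∀ β ∈ ν, T β ν) := by
  refine S.many_diag hT fun β hβ => ?_
  obtain ⟨γ, hγ, hγT⟩ := h β hβ
  refine S.upward _ (S.tail γ hγ) _ ?_ (fun z hz => ?_) fun z hz => (ZFSet.mem_sep.1 hz).1
  · exact S.model.sep_mem (P := T β) (Dfn.sub2 S.model hT
      (.const (S.model.trans S.card_mem hβ)) (.var 0)) S.card_mem
  · obtain ⟨h1, h2⟩ := ZFSet.mem_sep.1 hz
    exact ZFSet.mem_sep.2 ⟨h1, hγT z h1 h2⟩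

/-- The sets `{β < ν : R β ν}` cohere, for `U`-many `ν`, to a single set in `M`. -/
theorem exists_thread (S : UltraModel κ M v U) {R : ZFSet → ZFSet → Prop}
    (hR : Dfn M (fun w => R (w 0) (w 1))) :
    ∃ W ∈ M, W ⊆ κ ∧ Many U (fun ν => ν ∈ κ ∧ ∀ β ∈ ν, (β ∈ W ↔ R β ν)) := by
  let Q : ZFSet → ZFSet → Prop := fun β ν => ν = β ∨ (β ∈ ν ∧ R β ν)
  have hM := S.model
  have hQ : Dfn M (fun w => Q (w 0) (w 1)) :=
    .or (.eq hM (.var 1) (.var 0)) (.and (.mem hM (.var 0) (.var 1)) hR)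
  have hκM : ∀ β ∈ κ, β ∈ M := fun β hβ => hM.trans S.card_mem hβ
  have hG := Dfn.eqSep hM hQ S.card_mem
  have hGM : ∀ β ∈ κ, ZFSet.sep (Q β) κ ∈ M := fun β hβ => hM.sep_mem (P := Q β) (Dfn.sub2 hM hQ
      (.const (hκM β hβ)) (.var 0)) S.card_mem
  obtain ⟨F, hF, hFm⟩ := hM.graph_mem (G := fun β => ZFSet.sep (Q β) κ) hG S.card_mem hGM
  obtain ⟨I, hI, hIm⟩ := hM.image_mem (G := fun β => ZFSet.sep (Q β) κ) hG S.card_mem hGM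
  have hFp : ∀ β y, ZFSet.pair β y ∈ F ↔ β ∈ κ ∧ y = ZFSet.sep (Q β) κ := by
    intro β y
    rw [hFm]
    constructor
    · rintro ⟨x, hx, he⟩
      obtain ⟨rfl, rfl⟩ := ZFSet.pair_inj.1 he
      exact ⟨hx, rfl⟩
    · rintro ⟨hx, rfl⟩
      exact ⟨β, hx, rfl⟩
  have hself : ∀ β ∈ κ, β ∈ ZFSet.sep (Q β) κ := fun β hβ => ZFSet.mem_sep.2 ⟨hβ, Or.inl rfl⟩
  have hinj : ∀ β ∈ κ, ∀ β' ∈ κ, ZFSet.sep (Q β) κ = ZFSet.sep (Q β') κ → β = β' := by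
    intro β hβ β' hβ' h
    have h1 := hself β hβ
    have h2 := hself β' hβ'
    rw [h] at h1
    rw [← h] at h2
    rcases (ZFSet.mem_sep.1 h1).2 with h1 | ⟨h1, -⟩
    · exact h1
    rcases (ZFSet.mem_sep.1 h2).2 with h2 | ⟨h2, -⟩
    · exact h2.symm
    · exact absurd h2 (ZFSet.mem_asymm h1)
  obtain ⟨c, hc, hcm⟩ := S.amenable I hI ⟨F, hF, zIsBijFun_iff.2 ⟨⟨fun p hp => by
      obtain ⟨x, hx, rfl⟩ := (hFm p).1 hp; exact ⟨x, hx, _, rfl⟩,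
      fun x hx => ⟨_, (hFp _ _).2 ⟨hx, rfl⟩⟩,
      fun x y y' h h' => ((hFp _ _).1 h).2.trans ((hFp _ _).1 h').2.symm⟩,
    fun x y h => (hIm y).2 ⟨x, (hFp _ _).1 h⟩,
    fun x x' y h h' => hinj x ((hFp _ _).1 h).1 x' ((hFp _ _).1 h').1
      (((hFp _ _).1 h).2.symm.trans ((hFp _ _).1 h').2),
    fun y hy => ((hIm y).1 hy).imp fun x hx => ⟨hx.1, (hFp _ _).2 hx⟩⟩⟩
  let W : ZFSet := ZFSet.sep (fun β => ∃ y ∈ c, ZFSet.pair β y ∈ F) κ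
  have hWM : W ∈ M := hM.sep_mem (.bex hM (.const hc) (.pairMem hM (.const hF) (.var 1) (.var 0)))
    S.card_mem
  have hW : ∀ β ∈ κ, (β ∈ W ↔ ZFSet.sep (Q β) κ ∈ U) := by
    intro β hβ
    rw [ZFSet.mem_sep]
    constructor
    · rintro ⟨-, y, hy, h⟩
      obtain ⟨-, rfl⟩ := (hFp _ _).1 h
      exact ((hcm _).1 hy).2
    · intro h
      exact ⟨hβ, _, (hcm _).2 ⟨(hIm _).2 ⟨β, hβ, rfl⟩, h⟩, (hFp _ _).2 ⟨hβ, rfl⟩⟩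
  refine ⟨W, hWM, fun z hz => (ZFSet.mem_sep.1 hz).1, ?_⟩
  have hT : Dfn M (fun w => (w 0 ∈ W ↔ Q (w 0) (w 1))) := .iff (.mem hM (.var 0) (.const hWM)) hQ
  refine many_mono (S.many_diag (T := fun β ν => (β ∈ W ↔ Q β ν)) hT fun β hβ => ?_) ?_
  · have hTM : ZFSet.sep (fun ν => (β ∈ W ↔ Q β ν)) κ ∈ M :=
      hM.sep_mem (Dfn.sub2 hM (R := fun β ν => (β ∈ W ↔ Q β ν)) hT (.const (hκM β hβ)) (.var 0))
        S.card_mem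
    by_cases hb : ZFSet.sep (Q β) κ ∈ U
    · refine S.upward _ hb _ hTM (fun z hz => ?_) fun z hz => (ZFSet.mem_sep.1 hz).1
      obtain ⟨h1, h2⟩ := ZFSet.mem_sep.1 hz
      exact ZFSet.mem_sep.2 ⟨h1, iff_of_true ((hW β hβ).2 hb) h2⟩
    · have := (S.ultra _ (hGM β hβ) fun z hz => (ZFSet.mem_sep.1 hz).1).resolve_left hb
      refine S.upward _ this _ hTM (fun z hz => ?_) fun z hz => (ZFSet.mem_sep.1 hz).1
      obtain ⟨h1, h2⟩ := ZFSet.mem_sep.1 hz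
      exact ZFSet.mem_sep.2 ⟨h1, iff_of_false (fun h => hb ((hW β hβ).1 h))
        fun h => h2 (ZFSet.mem_sep.2 ⟨h1, h⟩)⟩
  · rintro ν ⟨hν, h⟩
    refine ⟨hν, fun β hβ => (h β hβ).trans ⟨?_, fun h => Or.inr ⟨hβ, h⟩⟩⟩
    rintro (rfl | ⟨-, h⟩)
    · exact absurd hβ (ZFSet.mem_irrefl _)
    · exact h

end UltraModel

/-- `δ = α + β` for `α, β, δ ∈ κ`. -/
def IsSum (κ α β δ : ZFSet) : Prop := α ∈ κ ∧ β ∈ κ ∧ δ ∈ κ ∧ δ = oadd α β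

/-- `α ∈ κ` is closed under doubling. -/
def DoublingClosed (κ α : ZFSet) : Prop := α ∈ κ ∧ ∀ γ ∈ α, oadd γ γ ∈ α

theorem oadd_mem_of_doublingClosed {κ α β μ : ZFSet} (hκ : κ.IsOrdinal) (hμ : DoublingClosed κ μ)
    (hα : α ∈ μ) (hβ : β ∈ μ) : oadd α β ∈ μ := by
  have ho := hκ.mem hμ.1
  have key : ∀ m ∈ μ, α.rank ≤ m.rank → β.rank ≤ m.rank → oadd α β ∈ μ := by
    intro m hm h1 h2
    have h3 := hμ.2 m hm
    rcases (add_le_add h1 h2).eq_or_lt with h | h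
    · rwa [oadd, h]
    · exact ho.mem_trans (Ordinal.toZFSet_mem_toZFSet_iff.2 h) h3
  rcases (ho.mem hα).mem_trichotomous (ho.mem hβ) with h | h | h
  · exact key β hβ (ZFSet.rank_lt_of_mem h).le le_rfl
  · exact key β hβ (h ▸ le_rfl) le_rfl
  · exact key α hα le_rfl (ZFSet.rank_lt_of_mem h).le

namespace UltraModel
variable {κ M v : ZFSet} {U : Set ZFSet} {P Q : ZFSet → Prop}

theorem eq_oadd_iff (S : UltraModel κ M v U) {α γ ε : ZFSet} (hα : α ∈ κ) (hγ : γ ∈ κ)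
    (hε : ε ∈ κ) :
    ε = oadd α γ ↔ ∀ z ∈ κ, z ∈ ε ↔ z ∈ α ∨ ∃ γ' ∈ γ, z = oadd α γ' := by
  have hαo := S.isOrdinal.mem hα
  have hγo := S.isOrdinal.mem hγ
  constructor
  · rintro rfl z -
    exact mem_oadd hαo hγo
  · intro h
    ext z
    refine ⟨fun hz => (mem_oadd hαo hγo).2 ((h z (S.isOrdinal.mem_trans hz hε)).1 hz), fun hz => ?_⟩
    exact (h z (S.isOrdinal.mem_trans hz (oadd_mem S.inacc hα γ hγ))).2 ((mem_oadd hαo hγo).1 hz)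

theorem isSum_iff (S : UltraModel κ M v U) {α β δ : ZFSet} :
    IsSum κ α β δ ↔ (α ∈ κ ∧ β ∈ κ ∧ δ ∈ κ) ∧ ∃ h ∈ v,
      (∀ γ ∈ β, ∀ ε ∈ κ, (ZFSet.pair γ ε ∈ h ↔
        ∀ z ∈ κ, (z ∈ ε ↔ z ∈ α ∨ ∃ γ' ∈ γ, ZFSet.pair γ' z ∈ h))) ∧
      ∀ z ∈ κ, (z ∈ δ ↔ z ∈ α ∨ ∃ γ ∈ β, ZFSet.pair γ z ∈ h) := by
  have key : ∀ {h : ZFSet} {γ ε : ZFSet}, α ∈ κ → γ ∈ κ → ε ∈ κ →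
      (∀ γ' ∈ γ, ∀ z ∈ κ, (ZFSet.pair γ' z ∈ h ↔ z = oadd α γ')) →
      (ε = oadd α γ ↔ ∀ z ∈ κ, (z ∈ ε ↔ z ∈ α ∨ ∃ γ' ∈ γ, ZFSet.pair γ' z ∈ h)) := by
    intro h γ ε hα hγ hε H
    rw [S.eq_oadd_iff hα hγ hε]
    refine forall₂_congr fun z hz => ?_
    have : (∃ γ' ∈ γ, z = oadd α γ') ↔ ∃ γ' ∈ γ, ZFSet.pair γ' z ∈ h :=
      exists_congr fun γ' => and_congr_right fun hγ' => (H γ' hγ' z hz).symm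
    rw [this]
  have tr : ∀ {x y : ZFSet}, x ∈ y → y ∈ κ → x ∈ κ := fun h h' => S.isOrdinal.mem_trans h h'
  constructor
  · rintro ⟨hα, hβ, hδ, rfl⟩
    obtain ⟨ξ, hξ, h1, h2⟩ : ∃ ξ ∈ κ, β ⊆ ξ ∧ oadd α β ⊆ ξ := by
      rcases (S.isOrdinal.mem hβ).mem_trichotomous (S.isOrdinal.mem hδ) with h | h | h
      · exact ⟨_, hδ, (S.isOrdinal.mem hδ).subset_of_mem h, fun _ => id⟩
      · exact ⟨_, hδ, fun x hx => h ▸ hx, fun _ => id⟩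
      · exact ⟨_, hβ, fun _ => id, (S.isOrdinal.mem hβ).subset_of_mem h⟩
    let h : ZFSet := ZFSet.sep (fun p => ∃ γ ∈ β, p = ZFSet.pair γ (oadd α γ)) (ZFSet.prod ξ ξ)
    have H : ∀ γ ∈ β, ∀ ε ∈ κ, (ZFSet.pair γ ε ∈ h ↔ ε = oadd α γ) := by
      intro γ hγ ε hε
      rw [ZFSet.mem_sep]
      constructor
      · rintro ⟨-, γ', -, he⟩
        obtain ⟨rfl, rfl⟩ := ZFSet.pair_inj.1 he
        rfl
      · rintro rfl
        exact ⟨ZFSet.pair_mem_prod.2 ⟨h1 hγ, h2 (oadd_mem_oadd hγ)⟩, γ, hγ, rfl⟩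
    exact ⟨⟨hα, hβ, hδ⟩, h, S.rel_mem_stage ξ hξ _ fun p hp => (ZFSet.mem_sep.1 hp).1,
      fun γ hγ ε hε => (H γ hγ ε hε).trans (key hα (tr hγ hβ) hε fun γ' hγ' =>
        H γ' ((S.isOrdinal.mem hβ).mem_trans hγ' hγ)), (key hα hβ hδ H).1 rfl⟩
  · rintro ⟨⟨hα, hβ, hδ⟩, h, -, H1, H2⟩
    have H : ∀ γ ∈ β, ∀ ε ∈ κ, (ZFSet.pair γ ε ∈ h ↔ ε = oadd α γ) := by
      intro γ
      induction γ using ZFSet.inductionOn with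
      | _ γ ih =>
      intro hγ ε hε
      exact (H1 γ hγ ε hε).trans (key hα (tr hγ hβ) hε fun γ' hγ' =>
        ih γ' hγ' ((S.isOrdinal.mem hβ).mem_trans hγ' hγ)).symm
    exact ⟨hα, hβ, hδ, (key hα hβ hδ H).2 H2⟩

theorem dfn_isSum (S : UltraModel κ M v U) : Dfn M (fun w => IsSum κ (w 0) (w 1) (w 2)) := by
  have hM := S.model
  have k := Tm.const S.card_mem
  simp only [S.isSum_iff]
  refine .and (.and (.mem hM (.var 0) k) (.and (.mem hM (.var 1) k) (.mem hM (.var 2) k)))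
    (.bex hM (.const S.stage_mem) (.and (.ball hM (.var 2) (.ball hM k (.iff
      (.pairMem hM (.var 2) (.var 1) (.var 0)) (.ball hM k (.iff (.mem hM (.var 0) (.var 1))
        (.or (.mem hM (.var 0) (.var 4)) (.bex hM (.var 2)
          (.pairMem hM (.var 4) (.var 0) (.var 1)))))))))
      (.ball hM k (.iff (.mem hM (.var 0) (.var 4)) (.or (.mem hM (.var 0) (.var 2))
        (.bex hM (.var 3) (.pairMem hM (.var 2) (.var 0) (.var 1))))))))

theorem dfn_doublingClosed (S : UltraModel κ M v U) :
    Dfn M (fun w => DoublingClosed κ (w 0)) := by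
  have hM := S.model
  have h : Dfn M (fun w => w 0 ∈ κ ∧ ∀ γ ∈ w 0, ∃ δ ∈ w 0, IsSum κ γ γ δ) :=
    .and (.mem hM (.var 0) (.const S.card_mem)) (.ball hM (.var 0) (.bex hM (.var 1)
      (Dfn.sub3 hM S.dfn_isSum (.var 1) (.var 1) (.var 0))))
  refine h.congr fun w _ => ?_
  refine and_congr_right fun h => forall₂_congr fun γ hγ => ⟨fun h' => ⟨_, h', ?_⟩, ?_⟩
  · exact ⟨S.isOrdinal.mem_trans hγ h, S.isOrdinal.mem_trans hγ h, S.isOrdinal.mem_trans h' h, rfl⟩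
  · rintro ⟨δ, hδ, -, -, -, rfl⟩
    exact hδ

theorem many_doublingClosed (S : UltraModel κ M v U) : Many U (DoublingClosed κ) := by
  have hM := S.model
  refine many_mono (S.many_forall_mem (T := fun β ν => ∃ δ ∈ ν, IsSum κ β β δ)
    (.bex hM (.var 1) (Dfn.sub3 hM S.dfn_isSum (.var 1) (.var 1) (.var 0))) fun β hβ =>
      ⟨_, oadd_mem S.inacc hβ β hβ, fun ν hν h => ⟨_, h, hβ, hβ, oadd_mem S.inacc hβ β hβ, rfl⟩⟩) ?_
  rintro ν ⟨hν, h⟩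
  refine ⟨hν, fun γ hγ => ?_⟩
  obtain ⟨δ, hδ, -, -, -, rfl⟩ := h γ hγ
  exact hδ

theorem doublingClosed_inj (S : UltraModel κ M v U) {α α' β β' : ZFSet}
    (hα : DoublingClosed κ α) (hα' : DoublingClosed κ α') (hβ : β ∈ α) (hβ' : β' ∈ α')
    (h : oadd α β = oadd α' β') : α = α' ∧ β = β' :=
  oadd_inj (S.isOrdinal.mem hα.1) (S.isOrdinal.mem hα'.1) hα.2 hα'.2 hβ hβ' h

/-- A binary version of `exists_thread`. -/
theorem exists_pair_thread (S : UltraModel κ M v U) {R : ZFSet → ZFSet → ZFSet → Prop}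
    (hR : Dfn M (fun w => R (w 0) (w 1) (w 2))) :
    ∃ W ∈ M, Many U (fun μ => DoublingClosed κ μ ∧
      ∀ α ∈ μ, DoublingClosed κ α → ∀ β ∈ α, (oadd α β ∈ W ↔ R α β μ)) := by
  have hM := S.model
  obtain ⟨W, hW, -, h⟩ := S.exists_thread (R := fun δ μ => ∃ α ∈ κ, ∃ β ∈ α, DoublingClosed κ α ∧
    IsSum κ α β δ ∧ R α β μ) (.bex hM (.const S.card_mem) (.bex hM (.var 0)
      (.and (Dfn.sub1 hM S.dfn_doublingClosed (.var 1)) (.and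
        (Dfn.sub3 hM S.dfn_isSum (.var 1) (.var 0) (.var 2))
        (Dfn.sub3 hM hR (.var 1) (.var 0) (.var 3))))))
  refine ⟨W, hW, many_mono (S.many_and S.many_doublingClosed h) ?_⟩
  rintro μ ⟨hμ, hμκ, h⟩
  refine ⟨hμ, fun α hα hαc β hβ => ?_⟩
  have hβμ := (S.isOrdinal.mem hμκ).mem_trans hβ hα
  refine (h _ (oadd_mem_of_doublingClosed S.isOrdinal hμ hα hβμ)).trans ⟨?_, fun hR => ?_⟩
  · rintro ⟨α', -, β', hβ', hα'c, hs, hR⟩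
    obtain ⟨rfl, rfl⟩ := S.doublingClosed_inj hαc hα'c hβ hβ' hs.2.2.2
    exact hR
  · have hβκ := S.isOrdinal.mem_trans hβ hαc.1
    exact ⟨α, hαc.1, β, hβ, hαc, ⟨hαc.1, hβκ, oadd_mem S.inacc hαc.1 β hβκ, rfl⟩, hR⟩

theorem exists_uniformization (S : UltraModel κ M v U) {B : ZFSet → ZFSet → Prop}
    (hB : Dfn M (fun w => B (w 0) (w 1))) :
    ∃ P : ZFSet → ZFSet → Prop, Dfn M (fun w => P (w 0) (w 1)) ∧
      (∀ x y, P x y → y ∈ v ∧ B x y) ∧ (∀ x y y', P x y → P x y' → y = y') ∧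
      ∀ x, (∃ y ∈ v, B x y) → ∃ y, P x y := by
  have hM := S.model
  obtain ⟨o, ho, hoo, f, hf, hb⟩ := S.wellOrder
  obtain ⟨hfn, hr, hinj, hsurj⟩ := zIsBijFun_iff.1 hb
  have V := Tm.const S.stage_mem
  have F := Tm.const hf
  refine ⟨fun x y => (y ∈ v ∧ B x y) ∧ ∃ ξ ∈ o, ZFSet.pair ξ y ∈ f ∧
    ∀ η ∈ ξ, ∀ y' ∈ v, ZFSet.pair η y' ∈ f → ¬ B x y', ?_, fun x y h => h.1, ?_, ?_⟩
  · exact .and (.and (.mem hM (.var 1) V) hB) (.bex hM (.const ho) (.and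
      (.pairMem hM F (.var 0) (.var 2)) (.ball hM (.var 0) (.ball hM V (.imp
        (.pairMem hM F (.var 1) (.var 0)) (.not (Dfn.sub2 hM hB (.var 3) (.var 0))))))))
  · rintro x y y' ⟨⟨hy, hxy⟩, ξ, hξ, h1, h2⟩ ⟨⟨hy', hxy'⟩, ξ', hξ', h1', h2'⟩
    rcases (hoo.mem hξ).mem_trichotomous (hoo.mem hξ') with h | rfl | h
    · exact absurd hxy (h2' ξ h y hy h1)
    · exact hfn.2.2 _ _ _ h1 h1'
    · exact absurd hxy' (h2 ξ' h y' hy' h1')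
  · rintro x ⟨y, hy, hxy⟩
    obtain ⟨ξ, hξ, hξy⟩ := hsurj y hy
    obtain ⟨ξ, ⟨hξ, y, hy, h1, h2⟩, hmin⟩ := ZFSet.mem_wf.has_min
      {ξ | ξ ∈ o ∧ ∃ y ∈ v, ZFSet.pair ξ y ∈ f ∧ B x y} ⟨ξ, hξ, y, hy, hξy, hxy⟩
    exact ⟨y, ⟨hy, h2⟩, ξ, hξ, h1, fun η hη y' hy' h hb =>
      hmin η ⟨hoo.mem_trans hη hξ, y', hy', h, hb⟩ hη⟩

end UltraModel

/-- The relation `r` codes a sequence on `ν` for which no subset of `ν` in `v` is stationarily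
often a thread, as far as clubs in `v` are concerned. -/
def NoThread (v ν r : ZFSet) : Prop :=
  ∀ A ∈ v, A ⊆ ν → ∃ C ∈ v, ClubIn C ν ∧ ∀ α ∈ C, ∃ β ∈ α, ¬ (β ∈ A ↔ ZFSet.pair α β ∈ r)

namespace UltraModel
variable {κ M v : ZFSet} {U : Set ZFSet}

theorem dfn_clubIn (S : UltraModel κ M v U) : Dfn M (fun w => ClubIn (w 0) (w 1)) := by
  have hM := S.model
  have h : Dfn M (fun w => w 0 ⊆ w 1 ∧ (∀ γ ∈ w 1, ∃ δ ∈ w 0, γ ∈ δ) ∧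
      ∀ δ ∈ w 1, (∃ γ ∈ δ, γ ∈ δ) → (∀ γ ∈ δ, ∃ ε ∈ w 0, ε ∈ δ ∧ γ ∈ ε) → δ ∈ w 0) :=
    .and (.subset hM (.var 0) (.var 1)) (.and (.ball hM (.var 1) (.bex hM (.var 1)
      (.mem hM (.var 1) (.var 0)))) (.ball hM (.var 1) (.imp (.bex hM (.var 0)
        (.mem hM (.var 0) (.var 1))) (.imp (.ball hM (.var 0) (.bex hM (.var 2) (.and
          (.mem hM (.var 0) (.var 2)) (.mem hM (.var 1) (.var 0))))) (.mem hM (.var 0) (.var 1))))))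
  refine h.congr fun w _ => ?_
  simp only [and_self]
  exact Iff.rfl

theorem dfn_noThread (S : UltraModel κ M v U) : Dfn M (fun w => NoThread v (w 0) (w 1)) := by
  have hM := S.model
  have V := Tm.const S.stage_mem
  exact .ball hM V (.imp (.subset hM (.var 0) (.var 1)) (.bex hM V (.and
    (Dfn.sub2 hM S.dfn_clubIn (.var 0) (.var 2)) (.ball hM (.var 0) (.bex hM (.var 0) (.not (.iff
      (.mem hM (.var 0) (.var 3)) (.pairMem hM (.var 5) (.var 1) (.var 0)))))))))

theorem ineffableZ_of_not_noThread (S : UltraModel κ M v U) {ν : ZFSet} (hν : ν ∈ κ)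
    (h : ¬ ∃ r ∈ v, NoThread v ν r) : IneffableZ ν := by
  intro f hf hfs
  obtain ⟨-, -, huniq⟩ := zIsFuncOn_iff.1 hf
  have hνo := S.isOrdinal.mem hν
  let r : ZFSet := ZFSet.sep (fun p => ∃ α β y, p = ZFSet.pair α β ∧ ZFSet.pair α y ∈ f ∧ β ∈ y)
    (ZFSet.prod ν ν)
  have hr : ∀ α ∈ ν, ∀ β ∈ α, (ZFSet.pair α β ∈ r ↔ ∃ y, ZFSet.pair α y ∈ f ∧ β ∈ y) := by
    intro α hα β hβ
    rw [ZFSet.mem_sep]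
    constructor
    · rintro ⟨-, α', β', y, he, hy⟩
      obtain ⟨rfl, rfl⟩ := ZFSet.pair_inj.1 he
      exact ⟨y, hy⟩
    · rintro ⟨y, hy⟩
      exact ⟨ZFSet.pair_mem_prod.2 ⟨hα, hνo.mem_trans hβ hα⟩, α, β, y, rfl, hy⟩
  have hrv : r ∈ v := S.rel_mem_stage ν hν r fun p hp => (ZFSet.mem_sep.1 hp).1
  have h1 : ¬ NoThread v ν r := fun h' => h ⟨r, hrv, h'⟩
  rw [NoThread] at h1
  push Not at h1
  obtain ⟨A, -, hAν, hA⟩ := h1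
  refine ⟨A, hAν, fun C hC => ?_⟩
  obtain ⟨α, hαC, hα⟩ := hA C (S.subset_mem_stage ν hν C hC.1) hC
  have hαν := hC.1 hαC
  refine ⟨α, hαC, fun y hy z => ?_⟩
  constructor
  · intro hz
    have hzα := hfs α y hy hz
    exact ⟨(hα z hzα).2 ((hr α hαν z hzα).2 ⟨y, zApp_iff.1 hy, hz⟩), hzα⟩
  · rintro ⟨hzA, hzα⟩
    obtain ⟨y', hy', hz⟩ := (hr α hαν z hzα).1 ((hα z hzα).1 hzA)
    rwa [huniq _ _ _ (zApp_iff.1 hy) hy']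

theorem many_not_noThread (S : UltraModel κ M v U) :
    Many U (fun ν => ¬ ∃ r ∈ v, NoThread v ν r) := by
  have hM := S.model
  have V := Tm.const S.stage_mem
  refine (S.many_or_not (P := fun ν => ∃ r ∈ v, NoThread v ν r)
    (.bex hM V (Dfn.sub2 hM S.dfn_noThread (.var 1) (.var 0)))).resolve_left fun hY => ?_
  obtain ⟨Pr, dPr, pr1, pr2, pr3⟩ := S.exists_uniformization S.dfn_noThread
  obtain ⟨W₁, hW₁, X₁⟩ := S.exists_pair_thread
    (R := fun α β μ => ∃ r ∈ v, Pr μ r ∧ ZFSet.pair α β ∈ r)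
    (.bex hM V (.and (Dfn.sub2 hM dPr (.var 3) (.var 0)) (.pairMem hM (.var 0) (.var 1) (.var 2))))
  obtain ⟨A, hA, -, X₂⟩ := S.exists_thread (R := fun β α => ∃ δ ∈ W₁, IsSum κ α β δ)
    (.bex hM (.const hW₁) (Dfn.sub3 hM S.dfn_isSum (.var 2) (.var 1) (.var 0)))
  obtain ⟨Pc, dPc, pc1, pc2, pc3⟩ := S.exists_uniformization
    (B := fun μ C => ClubIn C μ ∧ ∀ r ∈ v, Pr μ r → ∀ α ∈ C, ∃ β ∈ α,
      ¬ (β ∈ A ↔ ZFSet.pair α β ∈ r))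
    (.and (Dfn.sub2 hM S.dfn_clubIn (.var 1) (.var 0)) (.ball hM V (.imp
      (Dfn.sub2 hM dPr (.var 1) (.var 0)) (.ball hM (.var 2) (.bex hM (.var 0) (.not (.iff
        (.mem hM (.var 0) (.const hA)) (.pairMem hM (.var 2) (.var 1) (.var 0)))))))))
  have hC : ∀ μ ∈ κ, (∃ r ∈ v, NoThread v μ r) → ∃ C, Pc μ C := by
    intro μ hμ h
    obtain ⟨r, hr⟩ := pr3 μ h
    obtain ⟨C, hCv, hC, hCr⟩ := (pr1 μ r hr).2 (ZFSet.sep (· ∈ A) μ)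
      (S.subset_mem_stage μ hμ _ fun z hz => (ZFSet.mem_sep.1 hz).1)
      fun z hz => (ZFSet.mem_sep.1 hz).1
    refine pc3 μ ⟨C, hCv, hC, fun r' _ hr' α hα => ?_⟩
    obtain ⟨β, hβ, h⟩ := hCr α hα
    rw [ZFSet.mem_sep, and_iff_right ((S.isOrdinal.mem hμ).mem_trans hβ (hC.1 hα))] at h
    exact ⟨β, hβ, pr2 _ _ _ hr hr' ▸ h⟩
  obtain ⟨W₃, hW₃, -, X₃⟩ := S.exists_thread (R := fun γ μ => ∃ C ∈ v, Pc μ C ∧ γ ∈ C)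
    (.bex hM V (.and (Dfn.sub2 hM dPc (.var 2) (.var 0)) (.mem hM (.var 1) (.var 0))))
  have X₃' : Many U (fun μ => μ ∈ κ ∧ ∃ C, Pc μ C ∧ ∀ γ ∈ μ, (γ ∈ W₃ ↔ γ ∈ C)) := by
    refine many_mono (S.many_and X₃ hY) ?_
    rintro μ ⟨⟨hμ, h⟩, hr⟩
    obtain ⟨C, hCμ⟩ := hC μ hμ hr
    refine ⟨hμ, C, hCμ, fun γ hγ => (h γ hγ).trans ⟨?_, fun h => ⟨C, (pc1 _ _ hCμ).1, hCμ, h⟩⟩⟩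
    rintro ⟨C', -, hC', h⟩
    exact pc2 _ _ _ hC' hCμ ▸ h
  have X₄ := S.many_forall_mem (T := fun β α => ∃ γ ∈ α, β ∈ γ ∧ γ ∈ W₃)
    (.bex hM (.var 1) (.and (.mem hM (.var 1) (.var 0)) (.mem hM (.var 0) (.const hW₃))))
    fun β hβ => by
      obtain ⟨μ, hμ, hβμ, -, C, hC, hW⟩ := S.many_exists X₃' hβ
      have hc := (pc1 _ _ hC).2.1
      obtain ⟨δ, hδ, hβδ⟩ := hc.2.1 β hβμ
      exact ⟨δ, S.isOrdinal.mem_trans (hc.1 hδ) hμ, fun ν hν h =>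
        ⟨δ, h, hβδ, (hW δ (hc.1 hδ)).2 hδ⟩⟩
  obtain ⟨ω, -, -, hω⟩ := S.inacc.2.1
  obtain ⟨α, hα, hωα, ⟨-, hα4⟩, ⟨-, hα2⟩, hαE⟩ :=
    S.many_exists (S.many_and X₄ (S.many_and X₂ S.many_doublingClosed)) hω
  obtain ⟨μ, hμ, hαμ, ⟨hμE, hμ1⟩, ⟨-, C, hC, hW⟩, hr⟩ :=
    S.many_exists (S.many_and X₁ (S.many_and X₃' hY)) hα
  obtain ⟨r, hr⟩ := pr3 μ hr
  obtain ⟨-, hc, hcr⟩ := pc1 _ _ hC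
  have hαC : α ∈ C := hc.2.2 α hαμ ⟨ω, hωα⟩ fun γ hγ => by
    obtain ⟨ε, hε, hγε, hεW⟩ := hα4 γ hγ
    exact ⟨ε, (hW ε ((S.isOrdinal.mem hμ).mem_trans hε hαμ)).1 hεW, hε, hγε⟩
  obtain ⟨β, hβ, h⟩ := hcr r (pr1 _ _ hr).1 hr α hαC
  refine h ((hα2 β hβ).trans ?_)
  have h1 : (∃ δ ∈ W₁, IsSum κ α β δ) ↔ oadd α β ∈ W₁ := by
    constructor
    · rintro ⟨δ, hδ, -, -, -, rfl⟩
      exact hδ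
    · have hβκ := S.isOrdinal.mem_trans hβ hα
      exact fun h => ⟨_, h, hα, hβκ, oadd_mem S.inacc hα β hβκ, rfl⟩
  refine h1.trans ((hμ1 α hαμ hαE β hβ).trans ⟨?_, fun h => ⟨r, (pr1 _ _ hr).1, hr, h⟩⟩)
  rintro ⟨r', -, hr', h⟩
  exact pr2 _ _ _ hr' hr ▸ h

end UltraModel

theorem ZeroIterable.exists_ultraModel {κ : ZFSet} (h : ZeroIterable κ) {A : ZFSet} (hA : A ⊆ κ) :
    ∃ M v U, UltraModel κ M v U ∧ A ∈ M := by
  obtain ⟨M, U, hM, hAM, hU, hW⟩ := h.2 A hA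
  obtain ⟨v, S⟩ := BabyMeasurable.exists_ultraModel hM hU hW
  exact ⟨M, v, U, S, hAM⟩

theorem ZeroIterable.weaklyIneffableZ {κ : ZFSet} (h : ZeroIterable κ) : WeaklyIneffableZ κ := by
  intro f hf hfs
  obtain ⟨-, -, huniq⟩ := zIsFuncOn_iff.1 hf
  let B : ZFSet := ZFSet.sep (fun δ => ∃ ν, DoublingClosed κ ν ∧ ∃ β ∈ ν, ∃ y,
    ZFSet.pair ν y ∈ f ∧ β ∈ y ∧ δ = oadd ν β) κ
  obtain ⟨M, v, U, S, hB⟩ := h.exists_ultraModel (A := B) fun z hz => (ZFSet.mem_sep.1 hz).1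
  obtain ⟨W, -, hWκ, X⟩ := S.exists_thread (R := fun β ν => ∃ δ ∈ B, IsSum κ ν β δ)
    (.bex S.model (.const hB) (Dfn.sub3 S.model S.dfn_isSum (.var 2) (.var 1) (.var 0)))
  refine ⟨W, hWκ, fun γ hγ => ?_⟩
  obtain ⟨ν, hν, hγν, ⟨-, hνW⟩, hνE⟩ := S.many_exists (S.many_and X S.many_doublingClosed) hγ
  refine ⟨ν, hν, hγν, fun y hy z => ?_⟩
  rw [zApp_iff] at hy
  constructor
  · intro hz
    have hzν := hfs ν y (zApp_iff.2 hy) hz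
    have hzκ := S.isOrdinal.mem_trans hzν hν
    have hs := oadd_mem S.inacc hν z hzκ
    exact ⟨(hνW z hzν).2 ⟨_, ZFSet.mem_sep.2 ⟨hs, ν, hνE, z, hzν, y, hy, hz, rfl⟩,
      hν, hzκ, hs, rfl⟩, hzν⟩
  · rintro ⟨hzW, hzν⟩
    obtain ⟨δ, hδ, -, -, -, rfl⟩ := (hνW z hzν).1 hzW
    obtain ⟨-, ν', hν', β, hβ, y', hy', hβy', he⟩ := ZFSet.mem_sep.1 hδ
    obtain ⟨rfl, rfl⟩ := S.doublingClosed_inj hνE hν' hzν hβ he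
    rwa [huniq _ _ _ hy hy']

theorem ZeroIterable.exists_ineffableZ {κ : ZFSet} (h : ZeroIterable κ) {β : ZFSet} (hβ : β ∈ κ) :
    ∃ ν, β ∈ ν ∧ ν ∈ κ ∧ ZIsCard ν ∧ IneffableZ ν := by
  obtain ⟨M, v, U, S, hK⟩ := h.exists_ultraModel (A := ZFSet.sep ZIsCard κ)
    fun z hz => (ZFSet.mem_sep.1 hz).1
  have X := S.many_forall_mem (T := fun β ν => ∃ c ∈ ν, β ∈ c ∧ c ∈ ZFSet.sep ZIsCard κ)
    (.bex S.model (.var 1) (.and (.mem S.model (.var 1) (.var 0))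
      (.mem S.model (.var 0) (.const hK)))) fun β hβ => by
    obtain ⟨c, hc, hβc, hcard⟩ := exists_card_mem S.inacc hβ
    exact ⟨c, hc, fun ν hν h => ⟨c, h, hβc, ZFSet.mem_sep.2 ⟨hc, hcard⟩⟩⟩
  obtain ⟨ν, hν, hβν, ⟨-, hνK⟩, hr⟩ := S.many_exists (S.many_and X S.many_not_noThread) hβ
  refine ⟨ν, hβν, hν, zIsCard_of_limit (S.isOrdinal.mem hν) fun γ hγ => ?_,
    S.ineffableZ_of_not_noThread hν hr⟩
  obtain ⟨c, hc, hγc, hcK⟩ := hνK γ hγ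
  exact ⟨c, hc, hγc, (ZFSet.mem_sep.1 hcK).2⟩

/-- A 0-iterable cardinal is weakly ineffable and a limit of
ineffable cardinals. -/
theorem zeroIterable_weaklyIneffable_limit_of_ineffable (κ : ZFSet)
    (h : ZeroIterable κ) :
    WeaklyIneffableZ κ ∧
      ∀ β : ZFSet, β ∈ κ → ∃ ν : ZFSet, β ∈ ν ∧ ν ∈ κ ∧ ZIsCard ν ∧
        IneffableZ ν := by
  exact ⟨h.weaklyIneffableZ, fun β hβ => h.exists_ineffableZ hβ⟩

end BabyMeasurable
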